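/- arXiv:1603.05639 — 2 statements merged into one kernel-verified Lean document; each statement's English description precedes it below -/
import Mathlib

section
/- Let B be a positive integer and let ξ ∈ (0,1) be an irrational number all of whose continued fraction partial quotients a_i satisfy a_i ≤ B. For k ≥ 1 set x_k = (kξ) mod 1. Then there exists a constant c > 0 (depending only on B) such that for every n ≥ 1: (i) if x'_1 ≤ x'_2 ≤ … ≤ x'_n denotes the increasing rearrangement of x_1,…,x_n, then max_{1≤k≤n−1}(x'_{k+1} − x'_k) ≤ c/n; and (ii) every interval J ⊆ [0,1] of length 1/n contains at most B+2 of the points x_1,…,x_n. -/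
open Finset

open GenContFract in
theorem GenContFract.exists_int_contsAux_of (v : ℝ) (n : ℕ) :
    ∃ a b : ℤ, (GenContFract.of v).contsAux n = ⟨a, b⟩ := by
  induction n using Nat.twoStepInduction with
  | zero => exact ⟨1, 0, by simp [contsAux]⟩
  | one => exact ⟨⌊v⌋, 1, by simp [contsAux, of_h_eq_floor]⟩
  | more n ih₀ ih₁ =>
    obtain ⟨a₀, b₀, h₀⟩ := ih₀
    obtain ⟨a₁, b₁, h₁⟩ := ih₁
    rcases hs : (GenContFract.of v).s.get? n with _ | gp
    · exact ⟨a₁, b₁, by rw [← h₁]; simp [contsAux, hs]⟩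
    · obtain ⟨hgp, z, hz⟩ := of_partNum_eq_one_and_exists_int_partDen_eq hs
      refine ⟨z * a₁ + a₀, z * b₁ + b₀, ?_⟩
      rw [contsAux_recurrence hs h₀ h₁, hgp, hz]
      push_cast
      simp

theorem Irrational.not_terminatedAt_of {ξ : ℝ} (hξ : Irrational ξ) (n : ℕ) :
    ¬ (GenContFract.of ξ).TerminatedAt n := fun h => by
  obtain ⟨q, hq⟩ := (GenContFract.terminates_iff_rat ξ).1 ⟨n, h⟩
  exact hξ ⟨q, hq.symm⟩

theorem Irrational.dens_pos {ξ : ℝ} (hξ : Irrational ξ) (n : ℕ) :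
    0 < (GenContFract.of ξ).dens n :=
  lt_of_lt_of_le (by exact_mod_cast Nat.fib_pos.2 n.succ_pos)
    (GenContFract.succ_nth_fib_le_of_nth_den (Or.inr (hξ.not_terminatedAt_of (n - 1))))

/-- The `n`-th continuant denominator of an irrational number is at most the reduced denominator
of its `n`-th convergent. -/
theorem Irrational.dens_le_den_of_convs_eq {ξ : ℝ} (hξ : Irrational ξ) {n : ℕ} {r : ℚ}
    (hr : (GenContFract.of ξ).convs n = r) : (GenContFract.of ξ).dens n ≤ r.den := by
  set g := GenContFract.of ξ
  have hdet : g.nums n * g.dens (n + 1) - g.dens n * g.nums (n + 1) = (-1) ^ (n + 1) :=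
    SimpContFract.determinant (s := SimpContFract.of ξ) (hξ.not_terminatedAt_of n)
  have hpos : 0 < g.dens n := hξ.dens_pos n
  obtain ⟨a, b, hab⟩ := GenContFract.exists_int_contsAux_of ξ (n + 2)
  have ha : g.nums (n + 1) = a := by
    rw [GenContFract.num_eq_conts_a, GenContFract.nth_cont_eq_succ_nth_contAux, hab]
  have hb : g.dens (n + 1) = b := by
    rw [GenContFract.den_eq_conts_b, GenContFract.nth_cont_eq_succ_nth_contAux, hab]
  have hrd : (0 : ℝ) < r.den := by exact_mod_cast r.den_pos
  have hcross : g.nums n * r.den = r.num * g.dens n := by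
    have h1 : g.nums n / g.dens n = r.num / r.den := by
      rw [← Rat.cast_def, ← hr]; rfl
    rwa [div_eq_div_iff hpos.ne' hrd.ne'] at h1
  have key : g.dens n * ((r.num * b - r.den * a : ℤ) : ℝ) = (-1) ^ (n + 1) * r.den := by
    push_cast
    rw [← hdet, ha, hb]
    linear_combination (-(b : ℝ)) * hcross
  have habs : g.dens n * |((r.num * b - r.den * a : ℤ) : ℝ)| = r.den := by
    have := congrArg abs key
    rwa [abs_mul, abs_mul, abs_pow, abs_neg, abs_one, one_pow, one_mul, abs_of_pos hpos,
      abs_of_pos hrd] at this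
  have hne : r.num * b - r.den * a ≠ 0 := by
    intro h0
    rw [h0, Int.cast_zero, abs_zero, mul_zero] at habs
    exact hrd.ne habs
  have hone : (1 : ℝ) ≤ |((r.num * b - r.den * a : ℤ) : ℝ)| := by
    exact_mod_cast Int.one_le_abs hne
  nlinarith

/-- If all partial quotients are at most `B`, the `n`-th convergent misses `ξ` by more than
`1 / ((B + 2) * qₙ ^ 2)`. -/
theorem Irrational.lt_abs_sub_convs {ξ : ℝ} (hξ : Irrational ξ) {B : ℝ}
    (hB : ∀ (i : ℕ) (a : ℝ), (GenContFract.of ξ).partDens.get? i = some a → a ≤ B) (n : ℕ) :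
    1 / ((B + 2) * (GenContFract.of ξ).dens n ^ 2) < |ξ - (GenContFract.of ξ).convs n| := by
  have hterm := hξ.not_terminatedAt_of n
  rw [GenContFract.of_terminatedAt_n_iff_succ_nth_intFractPair_stream_eq_none] at hterm
  obtain ⟨ifp', hifp'⟩ := Option.ne_none_iff_exists'.1 hterm
  obtain ⟨ifp, hifp, hfr, rfl⟩ :=
    GenContFract.IntFractPair.succ_nth_stream_eq_some_iff.1 hifp'
  have hquot : ((⌊ifp.fr⁻¹⌋ : ℤ) : ℝ) ≤ B :=
    hB n _ (GenContFract.partDen_eq_s_b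
      (GenContFract.get?_of_eq_some_of_succ_get?_intFractPair_stream hifp'))
  have hinv : ifp.fr⁻¹ < B + 1 := (Int.lt_floor_add_one _).trans_le (by linarith)
  have hfrpos : 0 < ifp.fr :=
    lt_of_le_of_ne (GenContFract.IntFractPair.nth_stream_fr_nonneg hifp) hfr.symm
  have hsub := GenContFract.sub_convs_eq hifp
  simp only [if_neg hfr] at hsub
  have hpos : 0 < (GenContFract.of ξ).dens n := hξ.dens_pos n
  have hprev : ((GenContFract.of ξ).contsAux n).b ≤ (GenContFract.of ξ).dens n := by
    cases n with
    | zero => simp [GenContFract.contsAux]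
    | succ m => exact GenContFract.of_den_mono
  have hprev0 : 0 ≤ ((GenContFract.of ξ).contsAux n).b := GenContFract.zero_le_of_contsAux_b
  have hden : ((GenContFract.of ξ).contsAux (n + 1)).b = (GenContFract.of ξ).dens n := rfl
  rw [hden] at hsub
  set q := (GenContFract.of ξ).dens n
  set q' := ((GenContFract.of ξ).contsAux n).b
  have hinvpos : 0 < ifp.fr⁻¹ := inv_pos.2 hfrpos
  have hfac : 0 < ifp.fr⁻¹ * q + q' := by positivity
  rw [hsub, abs_div, abs_pow, abs_neg, abs_one, one_pow, abs_of_pos (mul_pos hpos hfac)]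
  apply one_div_lt_one_div_of_lt (mul_pos hpos hfac)
  have : ifp.fr⁻¹ * q + q' < (B + 2) * q := by nlinarith
  nlinarith

/-- An irrational number with partial quotients at most `B` is badly approximable, with
constant `1 / (B + 2)`. -/
theorem Irrational.lt_abs_mul_sub_of_partDens_le {ξ : ℝ} (hξ : Irrational ξ) {B : ℝ} (hB0 : 0 < B)
    (hB : ∀ (i : ℕ) (a : ℝ), (GenContFract.of ξ).partDens.get? i = some a → a ≤ B)
    {j : ℕ} (hj : 0 < j) (p : ℤ) : 1 / ((B + 2) * j) < |j * ξ - p| := by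
  have hjR : (0 : ℝ) < j := by exact_mod_cast hj
  by_contra! hle
  set r : ℚ := p / j with hr
  have hrR : (r : ℝ) = p / j := by rw [hr]; push_cast; rfl
  have hdvd : r.den ∣ j := by
    have h := Rat.den_dvd p j
    rw [Rat.divInt_eq_div, Int.cast_natCast, ← hr] at h
    exact_mod_cast h
  have hdle : (r.den : ℝ) ≤ j := by exact_mod_cast Nat.le_of_dvd hj hdvd
  have hdpos : (0 : ℝ) < r.den := by exact_mod_cast r.den_pos
  have habs : |ξ - r| ≤ 1 / ((B + 2) * (r.den : ℝ) ^ 2) := by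
    have h1 : |ξ - r| = |j * ξ - p| / j := by
      rw [hrR, ← abs_of_pos hjR, ← abs_div, abs_of_pos hjR]
      congr 1
      field_simp
    calc |ξ - r| ≤ 1 / ((B + 2) * j) / j := by rw [h1]; gcongr
      _ = 1 / ((B + 2) * (j : ℝ) ^ 2) := by field_simp
      _ ≤ _ := by gcongr
  obtain ⟨n, hn⟩ := Real.exists_convs_eq_rat (ξ := ξ) (q := r)
    (habs.trans_lt (one_div_lt_one_div_of_lt (by positivity) (by gcongr; linarith)))
  have hlt := hξ.lt_abs_sub_convs hB n
  have hqle := hξ.dens_le_den_of_convs_eq hn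
  have hqpos : 0 < (GenContFract.of ξ).dens n := hξ.dens_pos n
  rw [hn] at hlt
  have : 1 / ((B + 2) * (r.den : ℝ) ^ 2) ≤ 1 / ((B + 2) * (GenContFract.of ξ).dens n ^ 2) := by
    gcongr
  linarith

theorem Rat.exists_nat_mul_num_eq_add (r : ℚ) (m : ℤ) :
    ∃ j : ℕ, 1 ≤ j ∧ j ≤ r.den ∧ ∃ z : ℤ, (j : ℤ) * r.num = m + r.den * z := by
  have hcop : IsCoprime r.num (r.den : ℤ) := Rat.isCoprime_num_den r
  obtain ⟨u, w, huw⟩ := hcop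
  have hd : (0 : ℤ) < r.den := by exact_mod_cast r.den_pos
  have h0 := Int.emod_nonneg (m * u - 1) hd.ne'
  have h1 := Int.emod_lt_of_pos (m * u - 1) hd
  refine ⟨((m * u - 1) % r.den + 1).toNat, by omega, by omega,
    -(m * w) - (m * u - 1) / r.den * r.num, ?_⟩
  rw [Int.toNat_of_nonneg (by omega), Int.emod_def]
  linear_combination m * huw

/-- For a number with the bad approximability constant `1 / (B + 2)`, the first `n` multiples are
`(B + 3) / n`-dense modulo one. -/
theorem exists_abs_mul_sub_sub_lt {ξ B : ℝ} (hB0 : 0 < B)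
    (hbad : ∀ (j : ℕ) (p : ℤ), 0 < j → 1 / ((B + 2) * j) < |j * ξ - p|)
    {n : ℕ} (hn : 0 < n) (t : ℝ) :
    ∃ j ∈ Finset.Icc 1 n, ∃ z : ℤ, |j * ξ - z - t| < (B + 3) / n := by
  have hnR : (0 : ℝ) < n := by exact_mod_cast hn
  obtain ⟨r, hr, hrn⟩ := Real.exists_rat_abs_sub_le_and_den_le ξ hn
  have hd : (0 : ℝ) < r.den := by exact_mod_cast r.den_pos
  obtain ⟨j, hj1, hjd, z, hz⟩ := r.exists_nat_mul_num_eq_add ⌊t * r.den⌋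
  refine ⟨j, Finset.mem_Icc.2 ⟨hj1, hjd.trans hrn⟩, z, ?_⟩
  have hzR : (j : ℝ) * r.num = ⌊t * r.den⌋ + r.den * z := by exact_mod_cast hz
  have hrR : (r : ℝ) * r.den = r.num := by exact_mod_cast r.mul_den_eq_num
  have hjdR : (j : ℝ) ≤ r.den := by exact_mod_cast hjd
  have hstep : |r.den * ξ - r.num| ≤ 1 / (n + 1) := by
    calc |r.den * ξ - r.num| = r.den * |ξ - r| := by
          rw [← hrR, ← abs_of_pos hd, ← abs_mul, abs_of_pos hd]
          congr 1
          ring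
      _ ≤ r.den * (1 / ((n + 1) * r.den)) := by gcongr
      _ = 1 / (n + 1) := by field_simp
  have hinv : 1 / (r.den : ℝ) < (B + 2) / n := by
    have h1 := (hbad r.den r.num r.den_pos).trans_le hstep
    rw [div_lt_div_iff₀ (by positivity) (by positivity)] at h1
    rw [div_lt_div_iff₀ hd hnR]
    linarith
  have hdrift : |j * (ξ - r)| ≤ 1 / n := by
    rw [abs_mul, Nat.abs_cast]
    calc (j : ℝ) * |ξ - r| ≤ r.den * (1 / ((n + 1) * r.den)) := by gcongr
      _ = 1 / (n + 1) := by field_simp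
      _ ≤ 1 / n := by gcongr; linarith
  have hround : |⌊t * r.den⌋ / (r.den : ℝ) - t| ≤ 1 / r.den := by
    have h1 := Int.floor_le (t * r.den)
    have h2 := Int.lt_floor_add_one (t * r.den)
    rw [div_sub' hd.ne', abs_div, abs_of_pos hd]
    gcongr
    rw [abs_le]
    constructor <;> linarith
  have hsplit : j * ξ - z - t = j * (ξ - r) + (⌊t * r.den⌋ / (r.den : ℝ) - t) := by
    have : (⌊t * r.den⌋ : ℝ) / r.den = j * r - z := by
      rw [div_eq_iff hd.ne']
      linear_combination j * hrR.symm - hzR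
    rw [this]
    ring
  calc |j * ξ - z - t| ≤ 1 / n + 1 / r.den := by
        rw [hsplit]
        exact (abs_add_le _ _).trans (add_le_add hdrift hround)
    _ < 1 / n + (B + 2) / n := by gcongr
    _ = (B + 3) / n := by ring

theorem Finset.not_mem_of_sort_getElem_lt {s : Finset ℝ} {i : ℕ}
    (h : i + 1 < (s.sort (· ≤ ·)).length) {x : ℝ}
    (h1 : (s.sort (· ≤ ·))[i] < x) (h2 : x < (s.sort (· ≤ ·))[i + 1]) : x ∉ s := by
  intro hx
  obtain ⟨k, hk, rfl⟩ := List.getElem_of_mem ((Finset.mem_sort (· ≤ ·)).2 hx)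
  have hs : (s.sort (· ≤ ·)).SortedLT := Finset.sortedLT_sort s
  have := (hs.getElem_lt_getElem_iff).1 h1
  have := (hs.getElem_lt_getElem_iff).1 h2
  omega

/-- A map to `[0, m]` whose values on distinct points of a finite set are more than one apart
is defined on at most `m` points. -/
theorem Finset.card_le_of_one_lt_abs_sub {α : Type*} {s : Finset α} {f : α → ℝ} {m : ℕ}
    (hm : 0 < m) (hf0 : ∀ a ∈ s, 0 ≤ f a) (hfm : ∀ a ∈ s, f a ≤ m)
    (hsep : ∀ a ∈ s, ∀ b ∈ s, a ≠ b → 1 < |f a - f b|) : s.card ≤ m := by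
  rw [← Finset.card_range m]
  have hlow : ∀ a ∈ s, ((⌈f a⌉₊ - 1 : ℕ) : ℝ) ≤ f a := fun a ha => by
    have h1 := Nat.ceil_lt_add_one (hf0 a ha)
    rcases Nat.eq_zero_or_pos ⌈f a⌉₊ with h | h
    · simpa [h] using hf0 a ha
    · rw [Nat.cast_sub h]
      push_cast
      linarith
  have hhigh : ∀ a, f a ≤ ((⌈f a⌉₊ - 1 : ℕ) : ℝ) + 1 := fun a => by
    refine (Nat.le_ceil (f a)).trans ?_
    exact_mod_cast (by omega : ⌈f a⌉₊ ≤ ⌈f a⌉₊ - 1 + 1)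
  refine Finset.card_le_card_of_injOn (fun a => ⌈f a⌉₊ - 1) (fun a ha => ?_) fun a ha b hb hab => ?_
  · have := Nat.ceil_le.2 (hfm a ha)
    simp only [Finset.coe_range, Set.mem_Iio]
    omega
  · by_contra hne
    have h := hsep a ha b hb hne
    have ha1 := hlow a ha
    have ha2 := hhigh a
    have hb1 := hlow b hb
    have hb2 := hhigh b
    simp only at hab
    rw [hab] at ha1 ha2
    have : |f a - f b| ≤ 1 := by
      rw [abs_le]
      constructor <;> linarith
    linarith

theorem lt_abs_fract_sub_fract {ξ C : ℝ} (hC : 0 < C)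
    (hbad : ∀ (j : ℕ) (p : ℤ), 0 < j → 1 / (C * j) < |j * ξ - p|)
    {n k l : ℕ} (hk : k ∈ Finset.Icc 1 n) (hl : l ∈ Finset.Icc 1 n) (hkl : k ≠ l) :
    1 / (C * n) < |Int.fract (k * ξ) - Int.fract (l * ξ)| := by
  wlog hlt : l < k generalizing k l
  · rw [abs_sub_comm]
    exact this hl hk hkl.symm (by omega)
  rw [Finset.mem_Icc] at hk hl
  have hj : 0 < k - l := by omega
  have hjR : (0 : ℝ) < (k - l : ℕ) := by exact_mod_cast hj
  have hjn : ((k - l : ℕ) : ℝ) ≤ n := by exact_mod_cast (by omega : k - l ≤ n)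
  calc 1 / (C * n) ≤ 1 / (C * (k - l : ℕ)) := by gcongr
    _ < |(k - l : ℕ) * ξ - (⌊k * ξ⌋ - ⌊l * ξ⌋ : ℤ)| := hbad _ _ hj
    _ = _ := by
      congr 1
      rw [Nat.cast_sub hlt.le, Int.fract, Int.fract]
      push_cast
      ring

/-- Let `B` be a positive integer and `ξ ∈ (0,1)` irrational with all
continued fraction partial quotients `a_i ≤ B`. For `k ≥ 1` set `x_k = (kξ) mod 1`. Then there
is a constant `c > 0` depending only on `B` such that for every `n ≥ 1`: (i) consecutive gaps
of the increasing rearrangement of `x_1, …, x_n` are at most `c/n`; and (ii) every interval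
`J ⊆ [0,1]` of length `1/n` contains at most `B + 2` of the points `x_1, …, x_n`. -/
theorem three_distance_bounded_quotients (B : ℕ) (hB : 0 < B) :
    ∃ c : ℝ, 0 < c ∧
      ∀ ξ : ℝ, Irrational ξ → ξ ∈ Set.Ioo (0 : ℝ) 1 →
        (∀ (i : ℕ) (a : ℝ), (GenContFract.of ξ).partDens.get? i = some a → a ≤ (B : ℝ)) →
        ∀ n : ℕ, 1 ≤ n →
          (∀ i : ℕ,
            (h : i + 1 <
                (((Finset.Icc 1 n).image fun k : ℕ => Int.fract ((k : ℝ) * ξ)).sort (· ≤ ·)).length) →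
            (((Finset.Icc 1 n).image fun k : ℕ => Int.fract ((k : ℝ) * ξ)).sort (· ≤ ·))[i + 1]! -
              (((Finset.Icc 1 n).image fun k : ℕ => Int.fract ((k : ℝ) * ξ)).sort (· ≤ ·))[i]! ≤
              c / (n : ℝ)) ∧
          (∀ β : ℝ, 0 ≤ β → β + 1 / (n : ℝ) ≤ 1 →
            ((Finset.Icc 1 n).filter fun k : ℕ =>
                Int.fract ((k : ℝ) * ξ) ∈ Set.Icc β (β + 1 / (n : ℝ))).card ≤ B + 2) := by
  have hBR : (0 : ℝ) < B := by exact_mod_cast hB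
  refine ⟨2 * (B + 3), by positivity, fun ξ hξ _ hquot n hn => ?_⟩
  have hnR : (0 : ℝ) < n := by exact_mod_cast hn
  have hbad : ∀ (j : ℕ) (p : ℤ), 0 < j → 1 / (((B : ℝ) + 2) * j) < |j * ξ - p| :=
    fun j p hj => hξ.lt_abs_mul_sub_of_partDens_le hBR hquot hj p
  refine ⟨fun i h => ?_, fun β _ _ => ?_⟩
  · rw [getElem!_pos _ (i + 1) h, getElem!_pos _ i (by omega)]
    by_contra! hgap
    set s := (Finset.Icc 1 n).image fun k : ℕ => Int.fract ((k : ℝ) * ξ) with hs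
    have hmem : ∀ k (hk : k < (s.sort (· ≤ ·)).length),
        0 ≤ (s.sort (· ≤ ·))[k] ∧ (s.sort (· ≤ ·))[k] < 1 := fun k hk => by
      have hks : (s.sort (· ≤ ·))[k] ∈ s := (Finset.mem_sort (· ≤ ·)).1 (List.getElem_mem hk)
      obtain ⟨l, -, hl⟩ := Finset.mem_image.1 hks
      rw [← hl]
      exact ⟨Int.fract_nonneg _, Int.fract_lt_one _⟩
    have hu := (hmem i (by omega)).1
    have hv := (hmem (i + 1) h).2
    obtain ⟨j, hj, z, hz⟩ := exists_abs_mul_sub_sub_lt hBR hbad hn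
      (((s.sort (· ≤ ·))[i] + (s.sort (· ≤ ·))[i + 1]) / 2)
    rw [abs_lt] at hz
    have hc : 2 * ((B : ℝ) + 3) / n = 2 * ((B + 3) / n) := by ring
    rw [hc] at hgap
    have hfract : Int.fract (j * ξ) = j * ξ - z :=
      Int.fract_eq_iff.2 ⟨by linarith, by linarith, z, by ring⟩
    refine Finset.not_mem_of_sort_getElem_lt h (x := Int.fract (j * ξ)) ?_ ?_
      (Finset.mem_image_of_mem _ hj) <;> rw [hfract] <;> linarith
  · refine Finset.card_le_of_one_lt_abs_sub
      (f := fun k : ℕ => (((B : ℝ) + 2) * n) * (Int.fract (k * ξ) - β)) (by omega)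
      (fun k hk => ?_) (fun k hk => ?_) fun k hk l hl hkl => ?_
    · have := (Finset.mem_filter.1 hk).2.1
      have : 0 ≤ Int.fract (k * ξ) - β := by linarith
      positivity
    · have := (Finset.mem_filter.1 hk).2.2
      calc ((B : ℝ) + 2) * n * (Int.fract (k * ξ) - β) ≤ (B + 2) * n * (1 / n) := by
            gcongr
            linarith
        _ = ((B + 2 : ℕ) : ℝ) := by
            push_cast
            field_simp
    · have h := lt_abs_fract_sub_fract (by positivity) hbad (Finset.mem_filter.1 hk).1
        (Finset.mem_filter.1 hl).1 hkl
      have hpos : (0 : ℝ) < (B + 2) * n := by positivity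
      rw [← mul_sub, sub_sub_sub_cancel_right, abs_mul, abs_of_pos hpos]
      rwa [div_lt_iff₀' hpos] at h
end

section
/- There exist positive constants c and C such that for all sufficiently large n divisible by 4, the two-cycle chain with golden-ratio laziness satisfies c/n ≤ P^t(o,o) ≤ C/n for every integer t with n^{3/2}/50 ≤ t ≤ 10·n^{3/2}. -/
open Finset

/-- The state space of the two-cycle chain: a common vertex `o` (the `Sum.inl` state) together
with two cycles indexed by `Fin 2`; `Sum.inr (i, j)` is position `j+1 ∈ {1,…,n−1}` on cycle
`i` (cycle `1` of the paper is `i = 0`, the "left" cycle). -/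
abbrev TwoCycleState (n : ℕ) := Unit ⊕ (Fin 2 × Fin (n - 1))

/-- The golden-ratio laziness parameter `α = 2/(√5+1)`. -/
noncomputable def goldenAlpha : ℝ := 2 / (Real.sqrt 5 + 1)

/-- The holding probability: `α` at states of the left cycle whose position `j` satisfies
`n/4 ≤ j ≤ 3n/4`, and `1/2` everywhere else (including at `o`). -/
noncomputable def tcHold (n : ℕ) : TwoCycleState n → ℝ
  | Sum.inl _ => 1 / 2
  | Sum.inr (i, j) =>
      if i = 0 ∧ n / 4 ≤ (j : ℕ) + 1 ∧ (j : ℕ) + 1 ≤ 3 * n / 4 then goldenAlpha else 1 / 2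

/-- The conditional move distribution of the two-cycle chain: given that the chain moves, it
goes clockwise (position `+1`) with probability `2/3` and counter-clockwise (position `−1`)
with probability `1/3`; from `o` it additionally picks one of the two cycles uniformly. -/
noncomputable def tcStep (n : ℕ) : TwoCycleState n → TwoCycleState n → ℝ
  | Sum.inl _, Sum.inl _ => 0
  | Sum.inl _, Sum.inr (_, j) =>
      (if (j : ℕ) = 0 then 1 / 3 else 0) + (if (j : ℕ) + 2 = n then 1 / 6 else 0)
  | Sum.inr (_, j), Sum.inl _ =>
      (if (j : ℕ) + 2 = n then 2 / 3 else 0) + (if (j : ℕ) = 0 then 1 / 3 else 0)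
  | Sum.inr (i, j), Sum.inr (i', j') =>
      if i = i' then
        (if (j' : ℕ) = (j : ℕ) + 1 then 2 / 3 else 0) +
          (if (j' : ℕ) + 1 = (j : ℕ) then 1 / 3 else 0)
      else 0

/-- The transition matrix of the two-cycle chain with golden-ratio laziness: stay in place with
the holding probability, and otherwise move according to `tcStep`. -/
noncomputable def tcP (n : ℕ) : Matrix (TwoCycleState n) (TwoCycleState n) ℝ :=
  fun x y => (if x = y then tcHold n x else 0) + (1 - tcHold n x) * tcStep n x y

/-- The probability that a fair binomial variable with `t` trials equals `k`. -/
noncomputable def fairBinom (t k : ℕ) : ℝ := (t.choose k : ℝ) / 2 ^ t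

lemma fairBinom_nonneg (t k : ℕ) : 0 ≤ fairBinom t k := by
  unfold fairBinom; positivity

lemma centralBinom_sq_upper (N : ℕ) :
    (2 * N + 1) * N.centralBinom ^ 2 ≤ 16 ^ N := by
  induction N with
  | zero => simp
  | succ N ih =>
    have h := Nat.succ_mul_centralBinom_succ N
    have h2 : (N + 1) ^ 2 * (N + 1).centralBinom ^ 2
        = 4 * (2 * N + 1) ^ 2 * N.centralBinom ^ 2 := by
      rw [← mul_pow, h]; ring
    refine le_of_mul_le_mul_left (a := (N + 1) ^ 2) ?_ (by positivity)
    calc (N + 1) ^ 2 * ((2 * (N + 1) + 1) * (N + 1).centralBinom ^ 2)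
        = (2 * N + 3) * ((N + 1) ^ 2 * (N + 1).centralBinom ^ 2) := by ring
      _ = 4 * ((2 * N + 3) * (2 * N + 1)) * ((2 * N + 1) * N.centralBinom ^ 2) := by
        rw [h2]; ring
      _ ≤ 4 * (4 * (N + 1) ^ 2) * 16 ^ N := by
        exact Nat.mul_le_mul (Nat.mul_le_mul_left 4 (by nlinarith)) ih
      _ = (N + 1) ^ 2 * 16 ^ (N + 1) := by ring

lemma centralBinom_sq_lower (N : ℕ) (hN : 1 ≤ N) :
    16 ^ N ≤ 4 * N * N.centralBinom ^ 2 := by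
  induction N, hN using Nat.le_induction with
  | base => simp [Nat.centralBinom]
  | succ N hN ih =>
    have h := Nat.succ_mul_centralBinom_succ N
    have h2 : (N + 1) ^ 2 * (N + 1).centralBinom ^ 2
        = 4 * (2 * N + 1) ^ 2 * N.centralBinom ^ 2 := by
      rw [← mul_pow, h]; ring
    refine le_of_mul_le_mul_left (a := N + 1) ?_ (by positivity)
    calc (N + 1) * 16 ^ (N + 1) = 16 * (N + 1) * 16 ^ N := by ring
      _ ≤ 16 * (N + 1) * (4 * N * N.centralBinom ^ 2) := by gcongr
      _ = 16 * (4 * N * (N + 1)) * N.centralBinom ^ 2 := by ring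
      _ ≤ 16 * (2 * N + 1) ^ 2 * N.centralBinom ^ 2 := by gcongr; nlinarith
      _ = 4 * (4 * (2 * N + 1) ^ 2 * N.centralBinom ^ 2) := by ring
      _ = (N + 1) * (4 * (N + 1) * (N + 1).centralBinom ^ 2) := by rw [← h2]; ring

lemma fairBinom_center_upper (N : ℕ) : fairBinom (2 * N) N ≤ 1 / √(2 * N + 1) := by
  have h : ((2 * N + 1 : ℕ) : ℝ) * (N.centralBinom : ℝ) ^ 2 ≤ 16 ^ N := by
    exact_mod_cast centralBinom_sq_upper N
  unfold fairBinom
  rw [← Nat.centralBinom_eq_two_mul_choose, div_le_div_iff₀ (by positivity) (by positivity),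
    one_mul]
  refine abs_le_of_sq_le_sq' ?_ (by positivity) |>.2
  rw [mul_pow, Real.sq_sqrt (by positivity)]
  push_cast at h
  calc _ = (2 * (N : ℝ) + 1) * (N.centralBinom : ℝ) ^ 2 := by ring
    _ ≤ 16 ^ N := h
    _ = _ := by rw [← pow_mul, mul_right_comm, pow_mul]; norm_num

lemma fairBinom_center_lower (N : ℕ) (hN : 1 ≤ N) :
    1 / (2 * √N) ≤ fairBinom (2 * N) N := by
  have h : (16 : ℝ) ^ N ≤ 4 * N * (N.centralBinom : ℝ) ^ 2 := by
    exact_mod_cast centralBinom_sq_lower N hN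
  unfold fairBinom
  have hN' : (0 : ℝ) < N := by exact_mod_cast hN
  rw [← Nat.centralBinom_eq_two_mul_choose, div_le_div_iff₀ (by positivity) (by positivity),
    one_mul]
  refine abs_le_of_sq_le_sq' ?_ (by positivity) |>.2
  rw [mul_pow, mul_pow, Real.sq_sqrt (by positivity)]
  calc ((2 : ℝ) ^ (2 * N)) ^ 2 = 16 ^ N := by rw [← pow_mul, mul_right_comm, pow_mul]; norm_num
    _ ≤ _ := h
    _ = _ := by ring

lemma fairBinom_step (N j : ℕ) (hj : j < N) :
    fairBinom (2 * N) (N + (j + 1))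
      = fairBinom (2 * N) (N + j) * (((N : ℝ) - j) / (N + j + 1)) := by
  have h := Nat.choose_succ_right_eq (2 * N) (N + j)
  rw [show 2 * N - (N + j) = N - j by omega] at h
  have h' : ((2 * N).choose (N + j + 1) : ℝ) * (N + j + 1)
      = (2 * N).choose (N + j) * ((N : ℝ) - j) := by
    rw [← Nat.cast_sub hj.le]; exact_mod_cast h
  unfold fairBinom
  rw [← add_assoc]
  field_simp
  linarith

lemma fairBinom_offset_upper (N j : ℕ) :
    fairBinom (2 * N) (N + j)
      ≤ fairBinom (2 * N) N * Real.exp (-((j : ℝ) ^ 2 / (2 * N + 1))) := by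
  induction j with
  | zero => simp
  | succ j ih =>
    rcases lt_or_ge j N with hj | hj
    · rw [fairBinom_step N j hj]
      have hj' : (j : ℝ) + 1 ≤ N := by exact_mod_cast hj
      have hb : ((N : ℝ) - j) / (N + j + 1) ≤ Real.exp (-((2 * j + 1) / (2 * N + 1))) := by
        have h1 : ((N : ℝ) - j) / (N + j + 1) = 1 - (2 * j + 1) / (N + j + 1) := by
          field_simp; ring
        have h2 : (2 * (j : ℝ) + 1) / (2 * N + 1) ≤ (2 * j + 1) / (N + j + 1) := by
          gcongr; linarith
        have h3 := Real.add_one_le_exp (-((2 * (j : ℝ) + 1) / (2 * N + 1)))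
        linarith
      calc _ ≤ fairBinom (2 * N) N * Real.exp (-((j : ℝ) ^ 2 / (2 * N + 1)))
            * Real.exp (-((2 * j + 1) / (2 * N + 1))) := by
            gcongr
            · exact div_nonneg (by linarith) (by positivity)
            · exact mul_nonneg (fairBinom_nonneg _ _) (Real.exp_pos _).le
        _ = _ := by
            rw [mul_assoc, ← Real.exp_add]
            congr 2
            push_cast
            field_simp
            ring
    · have : fairBinom (2 * N) (N + (j + 1)) = 0 := by
        unfold fairBinom
        rw [Nat.choose_eq_zero_of_lt (by omega)]; simp
      rw [this]
      exact mul_nonneg (fairBinom_nonneg _ _) (Real.exp_pos _).le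

lemma exp_neg_two_mul_le_one_sub {x : ℝ} (h0 : 0 ≤ x) (h1 : x ≤ 1 / 2) :
    Real.exp (-(2 * x)) ≤ 1 - x := by
  have h := Real.exp_bound_div_one_sub_of_interval h0 (by linarith)
  have h2 : 1 / (1 - x) ≤ 1 + 2 * x := by
    rw [div_le_iff₀ (by linarith)]; nlinarith
  have h3 := Real.add_one_le_exp (2 * x)
  have h4 : 1 / (1 - x) ≤ Real.exp (2 * x) := by linarith
  rw [Real.exp_neg, inv_le_comm₀ (Real.exp_pos _) (by linarith)]
  simpa using h4

lemma fairBinom_offset_lower (N j : ℕ) (hj : 4 * j ≤ N) :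
    fairBinom (2 * N) N * Real.exp (-(2 * (j : ℝ) ^ 2 / N)) ≤ fairBinom (2 * N) (N + j) := by
  induction j with
  | zero => simp
  | succ j ih =>
    have ih := ih (by omega)
    rw [fairBinom_step N j (by omega)]
    have hj' : 4 * ((j : ℝ) + 1) ≤ N := by exact_mod_cast hj
    have hj0 : (0 : ℝ) ≤ j := Nat.cast_nonneg j
    have hN : (0 : ℝ) < N := by linarith
    have hb : Real.exp (-(2 * ((2 * j + 1) / N))) ≤ ((N : ℝ) - j) / (N + j + 1) := by
      have h1 : ((N : ℝ) - j) / (N + j + 1) = 1 - (2 * j + 1) / (N + j + 1) := by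
        field_simp; ring
      have h2 : (2 * (j : ℝ) + 1) / (N + j + 1) ≤ (2 * j + 1) / N := by
        gcongr; linarith
      have h4 : (2 * (j : ℝ) + 1) / N ≤ 1 / 2 := by
        rw [div_le_iff₀ hN]; linarith
      have h3 := exp_neg_two_mul_le_one_sub (x := (2 * (j : ℝ) + 1) / N) (by positivity) h4
      linarith
    calc _ = fairBinom (2 * N) N * Real.exp (-(2 * (j : ℝ) ^ 2 / N))
            * Real.exp (-(2 * ((2 * j + 1) / N))) := by
            rw [mul_assoc, ← Real.exp_add]
            congr 2
            push_cast
            field_simp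
            ring
      _ ≤ _ := by
            gcongr
            exact fairBinom_nonneg _ _

lemma fairBinom_symm (N j : ℕ) (hj : j ≤ N) :
    fairBinom (2 * N) (N - j) = fairBinom (2 * N) (N + j) := by
  unfold fairBinom
  rw [Nat.choose_symm_of_eq_add (show 2 * N = (N - j) + (N + j) by omega)]

lemma exists_offset (N k : ℕ) (hk : k ≤ 2 * N) :
    ∃ j : ℕ, fairBinom (2 * N) k = fairBinom (2 * N) (N + j) ∧
      |2 * (k : ℝ) - 2 * N| = 2 * j := by
  rcases le_total N k with h | h
  · obtain ⟨j, rfl⟩ := Nat.exists_eq_add_of_le h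
    refine ⟨j, rfl, ?_⟩
    rw [abs_of_nonneg] <;> push_cast <;> [ring; (ring_nf; positivity)]
  · refine ⟨N - k, ?_, ?_⟩
    · rw [← fairBinom_symm N (N - k) (by omega)]
      congr 1; omega
    · rw [Nat.cast_sub h, abs_of_nonpos]
      · ring
      · have : (k : ℝ) ≤ N := by exact_mod_cast h
        linarith

lemma fairBinom_even_upper (N k : ℕ) :
    fairBinom (2 * N) k
      ≤ Real.exp 1 / √(2 * N + 1) * Real.exp (-(|2 * (k : ℝ) - 2 * N| / √(2 * N + 1))) := by
  rcases le_or_gt k (2 * N) with hk | hk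
  · obtain ⟨j, h1, h2⟩ := exists_offset N k hk
    rw [h1, h2]
    refine (fairBinom_offset_upper N j).trans ?_
    have hs : (√(2 * (N : ℝ) + 1)) ^ 2 = 2 * N + 1 := Real.sq_sqrt (by positivity)
    have hpos : 0 < √(2 * (N : ℝ) + 1) := by positivity
    calc _ ≤ 1 / √(2 * N + 1) * Real.exp (1 - 2 * j / √(2 * N + 1)) := by
          gcongr
          · exact fairBinom_center_upper N
          · have e : (j : ℝ) ^ 2 / (2 * N + 1) = ((j : ℝ) / √(2 * N + 1)) ^ 2 := by
              rw [div_pow, hs]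
            rw [e, mul_div_assoc]
            nlinarith [sq_nonneg ((j : ℝ) / √(2 * N + 1) - 1)]
      _ = _ := by rw [sub_eq_add_neg, Real.exp_add]; ring
  · have : fairBinom (2 * N) k = 0 := by
      unfold fairBinom
      rw [Nat.choose_eq_zero_of_lt hk]; simp
    rw [this]; positivity

lemma fairBinom_succ_succ (t k : ℕ) :
    fairBinom (t + 1) (k + 1) = (fairBinom t k + fairBinom t (k + 1)) / 2 := by
  unfold fairBinom
  rw [Nat.choose_succ_succ, pow_succ]
  push_cast
  field_simp

lemma fairBinom_succ_ge (t k : ℕ) : fairBinom t k / 2 ≤ fairBinom (t + 1) k := by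
  cases k with
  | zero =>
    unfold fairBinom
    rw [Nat.choose_zero_right, Nat.choose_zero_right, pow_succ]
    apply le_of_eq; field_simp
  | succ k =>
    rw [fairBinom_succ_succ]
    have := fairBinom_nonneg t k
    linarith

lemma fairBinom_upper (t k : ℕ) :
    fairBinom t k ≤ 16 / √(t + 1) * Real.exp (-(|2 * (k : ℝ) - t| / √(t + 1))) := by
  have he : Real.exp 1 ≤ 4 := by linarith [Real.exp_one_lt_d9]
  rcases Nat.even_or_odd' t with ⟨N, rfl | rfl⟩
  · have h := fairBinom_even_upper N k
    push_cast
    refine h.trans ?_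
    gcongr
    linarith
  · have hs : 1 ≤ √(2 * (N : ℝ) + 1) := by
      rw [Real.one_le_sqrt]; linarith [(Nat.cast_nonneg N : (0 : ℝ) ≤ N)]
    have key : ∀ y : ℝ, |y - (2 * (k : ℝ) - (2 * N + 1))| ≤ 1 →
        Real.exp 1 / √(2 * N + 1) * Real.exp (-(|y| / √(2 * N + 1)))
          ≤ 16 / √(((2 * N + 1 : ℕ) : ℝ) + 1) *
            Real.exp (-(|2 * (k : ℝ) - ((2 * N + 1 : ℕ) : ℝ)| / √(((2 * N + 1 : ℕ) : ℝ) + 1))) := by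
      intro y hy
      push_cast
      set a := √(2 * (N : ℝ) + 1)
      have hab : a ≤ √(2 * (N : ℝ) + 1 + 1) := Real.sqrt_le_sqrt (by linarith)
      set b := √(2 * (N : ℝ) + 1 + 1) with hb
      have hbb : b ≤ 2 * a := by
        rw [hb, Real.sqrt_le_left (by positivity), mul_pow, Real.sq_sqrt (by positivity)]
        linarith [(Nat.cast_nonneg N : (0 : ℝ) ≤ N)]
      have ha : 0 < a := by linarith
      have hbp : 0 < b := by linarith
      set x := 2 * (k : ℝ) - (2 * N + 1)
      have hxy : |x| ≤ |y| + 1 := by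
        have := abs_sub_abs_le_abs_sub x y
        rw [abs_sub_comm x y] at this
        linarith
      have e1 : |x| / b ≤ |y| / a + 1 := by
        calc |x| / b ≤ |x| / a := by gcongr
          _ ≤ (|y| + 1) / a := by gcongr
          _ = |y| / a + 1 / a := by ring
          _ ≤ _ := by gcongr; rw [div_le_one ha]; exact hs
      calc Real.exp 1 / a * Real.exp (-(|y| / a))
          ≤ Real.exp 1 / a * Real.exp (1 + -(|x| / b)) := by gcongr; linarith
        _ = Real.exp 1 * Real.exp 1 * (1 / a) * Real.exp (-(|x| / b)) := by
            rw [Real.exp_add]; ring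
        _ ≤ 8 * (2 / b) * Real.exp (-(|x| / b)) := by
            have : Real.exp 1 * Real.exp 1 ≤ 8 := by
              nlinarith [Real.exp_one_lt_d9, Real.exp_pos 1]
            gcongr ?_ * ?_ * _
            rw [div_le_div_iff₀ ha hbp]; linarith
        _ = _ := by ring
    have h2 := (fairBinom_even_upper N k).trans (key (2 * k - 2 * N) (by
      rw [show (2 * (k : ℝ) - 2 * N - (2 * k - (2 * N + 1))) = 1 by ring]; simp))
    cases k with
    | zero =>
      have : fairBinom (2 * N + 1) 0 = fairBinom (2 * N) 0 / 2 := by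
        unfold fairBinom
        rw [Nat.choose_zero_right, Nat.choose_zero_right, pow_succ]
        field_simp
      have h0 := fairBinom_nonneg (2 * N) 0
      rw [this]; linarith
    | succ k =>
      have h1 := (fairBinom_even_upper N k).trans (key (2 * k - 2 * N) (by
        push_cast
        rw [show (2 * (k : ℝ) - 2 * N - (2 * (k + 1) - (2 * N + 1))) = -1 by ring]; simp))
      rw [fairBinom_succ_succ]
      linarith

lemma fairBinom_even_lower (N k : ℕ) (K : ℝ) (hK : 0 ≤ K) (hN : 1 ≤ N)
    (hKN : 4 * K ≤ √N) (hk : |2 * (k : ℝ) - 2 * N| ≤ 2 * (K * √N)) :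
    Real.exp (-(2 * K ^ 2)) / (2 * √N) ≤ fairBinom (2 * N) k := by
  have hN' : (0 : ℝ) < N := by exact_mod_cast hN
  have hsq : √(N : ℝ) * √N = N := Real.mul_self_sqrt hN'.le
  have hs : 0 < √(N : ℝ) := by positivity
  have hk2 : k ≤ 2 * N := by
    have := (abs_le.1 hk).2
    have : (k : ℝ) ≤ 2 * N := by nlinarith
    exact_mod_cast this
  obtain ⟨j, h1, h2⟩ := exists_offset N k hk2
  rw [h2] at hk
  have hj : (j : ℝ) ≤ K * √N := by linarith
  have h4 : 4 * j ≤ N := by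
    have : 4 * (j : ℝ) ≤ N := by nlinarith
    exact_mod_cast this
  rw [h1]
  refine le_trans ?_ (fairBinom_offset_lower N j h4)
  calc _ = 1 / (2 * √N) * Real.exp (-(2 * K ^ 2)) := by ring
    _ ≤ _ := by
      gcongr
      · exact fairBinom_nonneg _ _
      · exact fairBinom_center_lower N hN
      · rw [div_le_iff₀ hN']
        have : (j : ℝ) ^ 2 ≤ (K * √N) ^ 2 := by gcongr
        rw [mul_pow, pow_two (√(N : ℝ)), hsq] at this
        linarith

lemma fairBinom_lower (K : ℝ) (hK : 0 ≤ K) :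
    ∃ c : ℝ, 0 < c ∧ ∃ T : ℕ, ∀ t k : ℕ, T ≤ t → |2 * (k : ℝ) - t| ≤ K * √t →
      c / √t ≤ fairBinom t k := by
  set L : ℝ := K + 1
  refine ⟨Real.exp (-(2 * L ^ 2)) / 4, by positivity,
    2 * (⌈(4 * L) ^ 2⌉₊ + 1) + 1, ?_⟩
  intro t k ht hk
  obtain ⟨N, hN⟩ := Nat.even_or_odd' t
  have hceil : ⌈(4 * L) ^ 2⌉₊ + 1 ≤ N := by omega
  have hN1 : 1 ≤ N := by omega
  have hN1' : (1 : ℝ) ≤ N := by exact_mod_cast hN1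
  have hLN : 4 * L ≤ √N := by
    apply Real.le_sqrt_of_sq_le
    calc (4 * L) ^ 2 ≤ ⌈(4 * L) ^ 2⌉₊ := Nat.le_ceil _
      _ ≤ N := by exact_mod_cast (by omega)
  have hs1 : 1 ≤ √(N : ℝ) := by rwa [Real.one_le_sqrt]
  have ht2 : (t : ℝ) ≤ 2 * N + 1 := by
    have : t ≤ 2 * N + 1 := by omega
    exact_mod_cast this
  have ht1 : (2 * N : ℝ) ≤ t := by
    have : 2 * N ≤ t := by omega
    exact_mod_cast this
  have hst : √(t : ℝ) ≤ 2 * √N := by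
    rw [Real.sqrt_le_left (by positivity), mul_pow, Real.sq_sqrt (by positivity)]
    linarith
  have hst' : √(N : ℝ) ≤ √t := Real.sqrt_le_sqrt (by linarith)
  have hk' : |2 * (k : ℝ) - 2 * N| ≤ 2 * (L * √N) := by
    have h1 : |2 * (k : ℝ) - 2 * N| ≤ |2 * (k : ℝ) - t| + |(t : ℝ) - 2 * N| := by
      have := abs_add_le (2 * (k : ℝ) - t) (t - 2 * N)
      simpa using this
    have h2 : |(t : ℝ) - 2 * N| ≤ 1 := by rw [abs_le]; constructor <;> linarith
    have h3 : K * √t ≤ K * (2 * √N) := by gcongr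
    have : L * √N = K * √N + √N := by simp only [L]; ring
    rw [this]; linarith
  have hmain := fairBinom_even_lower N k L (by positivity) hN1 hLN hk'
  have hle : Real.exp (-(2 * L ^ 2)) / 4 / √t ≤ Real.exp (-(2 * L ^ 2)) / (2 * √N) / 2 := by
    rw [div_div, div_div, show 2 * √(N : ℝ) * 2 = 4 * √N by ring]
    gcongr
  have hpos : 0 ≤ Real.exp (-(2 * L ^ 2)) / (2 * √N) := by positivity
  rcases hN with rfl | rfl
  · linarith
  · have := fairBinom_succ_ge (2 * N) k
    linarith

/-- The power series `f` has nonnegative coefficients and converges at `z` to `B`. -/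
def NonnegEval (z : ℝ) (f : PowerSeries ℝ) (B : ℝ) : Prop :=
  (∀ k, 0 ≤ PowerSeries.coeff k f) ∧ HasSum (fun k => PowerSeries.coeff k f * z ^ k) B

lemma coeff_mul_nonneg {f g : PowerSeries ℝ} (hf : ∀ k, 0 ≤ PowerSeries.coeff k f)
    (hg : ∀ k, 0 ≤ PowerSeries.coeff k g) (k : ℕ) : 0 ≤ PowerSeries.coeff k (f * g) := by
  rw [PowerSeries.coeff_mul]
  exact sum_nonneg fun _ _ => mul_nonneg (hf _) (hg _)

lemma hasSum_antidiagonal_of_nonneg {f g : ℕ → ℝ} {B D : ℝ} (hf0 : 0 ≤ f) (hg0 : 0 ≤ g)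
    (hf : HasSum f B) (hg : HasSum g D) :
    HasSum (fun k => ∑ p ∈ antidiagonal k, f p.1 * g p.2) (B * D) := by
  have hm := hf.summable.mul_of_nonneg hg.summable hf0 hg0
  have h := hf.summable.tsum_mul_tsum_eq_tsum_sum_antidiagonal hg.summable hm
  rw [hf.tsum_eq, hg.tsum_eq] at h
  rw [h]
  exact (summable_sum_mul_antidiagonal_of_summable_mul hm).hasSum

lemma NonnegEval.mul {z B D : ℝ} {f g : PowerSeries ℝ} (hz : 0 ≤ z) (hf : NonnegEval z f B)
    (hg : NonnegEval z g D) : NonnegEval z (f * g) (B * D) := by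
  refine ⟨coeff_mul_nonneg hf.1 hg.1, ?_⟩
  have h := hasSum_antidiagonal_of_nonneg
    (fun k => mul_nonneg (hf.1 k) (pow_nonneg hz k))
    (fun k => mul_nonneg (hg.1 k) (pow_nonneg hz k)) hf.2 hg.2
  have e : (fun k => PowerSeries.coeff k (f * g) * z ^ k) = fun k => ∑ p ∈ antidiagonal k,
      PowerSeries.coeff p.1 f * z ^ p.1 * (PowerSeries.coeff p.2 g * z ^ p.2) := by
    funext k
    rw [PowerSeries.coeff_mul, sum_mul]
    refine sum_congr rfl fun p hp => ?_
    rw [← mem_antidiagonal.1 hp, pow_add]; ring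
  rw [e]; exact h

lemma NonnegEval.one (z : ℝ) : NonnegEval z 1 1 := by
  refine ⟨fun k => ?_, ?_⟩
  · rw [PowerSeries.coeff_one]; split_ifs <;> norm_num
  · convert hasSum_ite_eq (0 : ℕ) (1 : ℝ) using 2 with k
    rw [PowerSeries.coeff_one]
    split_ifs with h <;> simp [h]

lemma NonnegEval.pow {z B : ℝ} {f : PowerSeries ℝ} (hz : 0 ≤ z) (hf : NonnegEval z f B) (m : ℕ) :
    NonnegEval z (f ^ m) (B ^ m) := by
  induction m with
  | zero => simpa using NonnegEval.one z
  | succ m ih => rw [pow_succ, pow_succ]; exact ih.mul hz hf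

lemma NonnegEval.add {z B D : ℝ} {f g : PowerSeries ℝ} (hf : NonnegEval z f B)
    (hg : NonnegEval z g D) : NonnegEval z (f + g) (B + D) := by
  refine ⟨fun k => ?_, ?_⟩
  · rw [map_add]; exact add_nonneg (hf.1 k) (hg.1 k)
  · simpa [add_mul] using hf.2.add hg.2

lemma NonnegEval.sum_range_le {z B : ℝ} {f : PowerSeries ℝ} (hz : 0 ≤ z) (hf : NonnegEval z f B)
    (K : ℕ) : ∑ k ∈ range K, PowerSeries.coeff k f * z ^ k ≤ B :=
  sum_le_hasSum _ (fun k _ => mul_nonneg (hf.1 k) (by positivity)) hf.2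

lemma NonnegEval.nonneg {z B : ℝ} {f : PowerSeries ℝ} (hz : 0 ≤ z) (hf : NonnegEval z f B) :
    0 ≤ B := by
  simpa using hf.sum_range_le hz 0

/-- Renewal expansion: the solution of `U = R + V U` is `∑ R V ^ m`, coefficientwise. -/
lemma coeff_renewal {U R V : PowerSeries ℝ} (hU : U = R + V * U) (hV : PowerSeries.X ∣ V)
    {M k : ℕ} (hk : k < M) :
    PowerSeries.coeff k U = ∑ m ∈ range M, PowerSeries.coeff k (R * V ^ m) := by
  have h : ∀ M : ℕ, U = ∑ m ∈ range M, R * V ^ m + V ^ M * U := by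
    intro M
    induction M with
    | zero => simp
    | succ M ih =>
      rw [sum_range_succ]
      calc U = ∑ m ∈ range M, R * V ^ m + V ^ M * U := ih
        _ = ∑ m ∈ range M, R * V ^ m + V ^ M * (R + V * U) := by rw [← hU]
        _ = _ := by ring
  have h0 : PowerSeries.coeff k (V ^ M * U) = 0 :=
    PowerSeries.X_pow_dvd_iff.1 ((pow_dvd_pow_of_dvd hV M).mul_right U) k hk
  conv_lhs => rw [h M, map_add, h0, add_zero, map_sum]

lemma one_sub_inv_eq {S : PowerSeries ℝ} (hS : PowerSeries.X ∣ S) :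
    (1 - S)⁻¹ = 1 + S * (1 - S)⁻¹ := by
  have h0 : PowerSeries.constantCoeff (1 - S) ≠ 0 := by
    rw [map_sub, PowerSeries.X_dvd_iff.1 hS]; simp
  have := PowerSeries.mul_inv_cancel (1 - S) h0
  linear_combination this

lemma NonnegEval.one_sub_inv {z σ : ℝ} {S : PowerSeries ℝ} (hz : 0 ≤ z)
    (hS : PowerSeries.X ∣ S) (h : NonnegEval z S σ) (hσ : σ < 1) :
    NonnegEval z (1 - S)⁻¹ (1 / (1 - σ)) := by
  have heq := one_sub_inv_eq hS
  set R := (1 - S)⁻¹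
  have hσ0 := h.nonneg hz
  have hnn : ∀ k, 0 ≤ PowerSeries.coeff k R := by
    intro k
    rw [coeff_renewal heq hS (Nat.lt_succ_self k)]
    refine sum_nonneg fun m _ => ?_
    rw [one_mul]; exact (h.pow hz m).1 k
  have hsum : Summable fun k => PowerSeries.coeff k R * z ^ k := by
    refine summable_of_sum_range_le (c := (1 - σ)⁻¹)
      (fun k => mul_nonneg (hnn k) (by positivity)) fun K => ?_
    calc ∑ k ∈ range K, PowerSeries.coeff k R * z ^ k
        = ∑ k ∈ range K, ∑ m ∈ range K, PowerSeries.coeff k (S ^ m) * z ^ k := by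
          refine sum_congr rfl fun k hk => ?_
          rw [coeff_renewal heq hS (mem_range.1 hk), sum_mul]
          simp
      _ = ∑ m ∈ range K, ∑ k ∈ range K, PowerSeries.coeff k (S ^ m) * z ^ k := sum_comm
      _ ≤ ∑ m ∈ range K, σ ^ m := sum_le_sum fun m _ => (h.pow hz m).sum_range_le hz K
      _ ≤ (1 - σ)⁻¹ := sum_le_hasSum _ (fun m _ => by positivity)
          (hasSum_geometric_of_lt_one hσ0 hσ)
  obtain ⟨B, hB⟩ := hsum
  have hR : NonnegEval z R B := ⟨hnn, hB⟩
  have h1 := (NonnegEval.one z).add (h.mul hz hR)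
  rw [← heq] at h1
  have h2 := h1.2.unique hB
  have : B = 1 / (1 - σ) := by
    rw [eq_div_iff (by linarith)]; linarith
  rwa [← this]

/-- One-step average at position `x` for the biased walk with holding probabilities `H`. -/
noncomputable def stepAvg (H f : ℕ → ℝ) (x : ℕ) : ℝ :=
  H x * f x + (1 - H x) * (2 / 3 * f (x + 1) + 1 / 3 * f (x - 1))

/-- The expectation of `β` at the exit position, on the event that the biased walk with holding
probabilities `H` started at `x` leaves `{1, …, n - 1}` at time exactly `k`. -/
noncomputable def exitProb (n : ℕ) (H β : ℕ → ℝ) : ℕ → ℕ → ℝ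
  | 0, x => if 0 < x ∧ x < n then 0 else β x
  | k + 1, x => if 0 < x ∧ x < n then stepAvg H (exitProb n H β k) x else 0

/-- The probability, up to normalisation, of escaping to `+∞` from `x` before visiting `0`. -/
noncomputable def escapeProb (x : ℕ) : ℝ := 1 - (1 / 2) ^ x

/-- Holding probabilities are admissible if they are small enough for uniform estimates. -/
def Admissible (H : ℕ → ℝ) : Prop := ∀ x, 0 ≤ H x ∧ H x ≤ 6 / 25

section
variable {n : ℕ} {H β : ℕ → ℝ}

lemma stepAvg_mono (hH : Admissible H) {f g : ℕ → ℝ} {x : ℕ} (h0 : f x ≤ g x)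
    (h1 : f (x + 1) ≤ g (x + 1)) (h2 : f (x - 1) ≤ g (x - 1)) :
    stepAvg H f x ≤ stepAvg H g x := by
  have := hH x
  unfold stepAvg
  have hD : 0 ≤ 1 - H x := by linarith
  gcongr
  exact this.1

lemma exitProb_nonneg (hH : Admissible H) (hβ : ∀ x, 0 ≤ β x) (k x : ℕ) :
    0 ≤ exitProb n H β k x := by
  induction k generalizing x with
  | zero => rw [exitProb]; split_ifs <;> simp [hβ]
  | succ k ih =>
    rw [exitProb]
    split_ifs
    · calc (0 : ℝ) = stepAvg H 0 x := by simp [stepAvg]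
        _ ≤ _ := stepAvg_mono hH (ih _) (ih _) (ih _)
    · exact le_rfl

lemma exitProb_add (γ : ℕ → ℝ) (k x : ℕ) :
    exitProb n H (fun y => β y + γ y) k x = exitProb n H β k x + exitProb n H γ k x := by
  induction k generalizing x with
  | zero => simp only [exitProb]; split_ifs <;> simp
  | succ k ih =>
    simp only [exitProb, stepAvg, ih]
    split_ifs
    · ring
    · simp

lemma exitProb_eq_zero_of_lt (hβ : ∀ x < n, β x = 0) (k x : ℕ) (h : x + k < n) :
    exitProb n H β k x = 0 := by
  induction k generalizing x with
  | zero => rw [exitProb, hβ x (by omega)]; simp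
  | succ k ih =>
    rw [exitProb, stepAvg, ih x (by omega), ih (x + 1) (by omega), ih (x - 1) (by omega)]
    simp

/-- Comparison with a supersolution. -/
lemma exitProb_sum_le (hH : Admissible H) {z : ℝ} (hz : 0 ≤ z) {v : ℕ → ℝ}
    (hv0 : ∀ x, 0 ≤ v x) (hb0 : β 0 ≤ v 0) (hbn : β n ≤ v n)
    (hv : ∀ x, 0 < x → x < n → z * stepAvg H v x ≤ v x) (K x : ℕ) (hx : x ≤ n) :
    ∑ k ∈ range K, exitProb n H β k x * z ^ k ≤ v x := by
  induction K generalizing x with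
  | zero => simpa using hv0 x
  | succ K ih =>
    rw [sum_range_succ']
    by_cases hx' : 0 < x ∧ x < n
    · simp only [exitProb, hx', and_self, if_true, zero_mul, add_zero]
      calc ∑ k ∈ range K, stepAvg H (exitProb n H β k) x * z ^ (k + 1)
          = z * stepAvg H (fun y => ∑ k ∈ range K, exitProb n H β k y * z ^ k) x := by
            simp only [stepAvg, mul_sum, mul_add, ← sum_add_distrib]
            refine sum_congr rfl fun k _ => ?_
            ring
        _ ≤ z * stepAvg H v x := by
            gcongr
            exact stepAvg_mono hH (ih x hx) (ih (x + 1) (by omega)) (ih (x - 1) (by omega))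
        _ ≤ v x := hv x hx'.1 hx'.2
    · simp only [exitProb, hx', if_false, zero_mul, sum_const_zero, zero_add, pow_zero, mul_one]
      obtain rfl | rfl : x = 0 ∨ x = n := by omega
      · exact hb0
      · exact hbn

lemma stepAvg_const (c : ℝ) (x : ℕ) : stepAvg H (fun _ => c) x = c := by
  unfold stepAvg; ring

lemma exitProb_summable (hH : Admissible H) (hβ : ∀ x, 0 ≤ β x) (hβ1 : ∀ x, β x ≤ 1)
    {x : ℕ} (hx : x ≤ n) : Summable fun k => exitProb n H β k x := by
  refine summable_of_sum_range_le (c := 1) (fun k => exitProb_nonneg hH hβ k x) fun K => ?_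
  have := exitProb_sum_le (β := β) hH (z := 1) zero_le_one (v := fun _ => 1) (fun _ => zero_le_one)
    (hβ1 0) (hβ1 n) (fun x _ _ => by rw [stepAvg_const, one_mul]) K x hx
  simpa using this

lemma escapeProb_pos {x : ℕ} (hx : 0 < x) : 0 < escapeProb x := by
  unfold escapeProb
  have : ((1 : ℝ) / 2) ^ x < 1 := pow_lt_one₀ (by norm_num) (by norm_num) hx.ne'
  linarith

/-- The total exit weight is the explicit harmonic function with boundary values `β`. -/
lemma exitProb_hasSum (hn : 0 < n) (hH : Admissible H) (hβ : ∀ x, 0 ≤ β x) (hβ1 : ∀ x, β x ≤ 1)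
    {x : ℕ} (hx : x ≤ n) :
    HasSum (fun k => exitProb n H β k x)
      (β 0 + (β n - β 0) * (escapeProb x / escapeProb n)) := by
  have hs := fun (y : ℕ) (hy : y ≤ n) => (exitProb_summable (n := n) hH hβ hβ1 hy).hasSum
  set T : ℕ → ℝ := fun y => ∑' k, exitProb n H β k y with hT
  have hbd : ∀ y, ¬ (0 < y ∧ y < n) → T y = β y := by
    intro y hy
    rw [hT]
    simp only
    rw [tsum_eq_single 0]
    · simp [exitProb, hy]
    · intro k hk
      obtain ⟨k, rfl⟩ := Nat.exists_eq_succ_of_ne_zero hk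
      simp [exitProb, hy]
  have hharm : ∀ y, 0 < y → y < n → T y = stepAvg H T y := by
    intro y h0 h1
    have h2 : HasSum (fun k => exitProb n H β (k + 1) y) (stepAvg H T y) := by
      simp only [exitProb, h0, h1, and_self, if_true]
      exact ((hs y h1.le).mul_left _).add ((((hs (y + 1) h1).mul_left _).add
        ((hs (y - 1) (by omega)).mul_left _)).mul_left _)
    have h3 := (hasSum_nat_add_iff' (f := fun k => exitProb n H β k y) 1).2 (hs y h1.le)
    have h4 := h3.unique h2
    simpa [exitProb, h0, h1] using h4
  have hinc : ∀ y, y < n → T (y + 1) - T y = (T 1 - T 0) * (1 / 2) ^ y := by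
    intro y
    induction y with
    | zero => simp
    | succ y ih =>
      intro hy
      have h1 := ih (by omega)
      have h2 := hharm (y + 1) (by omega) hy
      unfold stepAvg at h2
      rw [Nat.add_sub_cancel] at h2
      have hD : (1 - H (y + 1)) ≠ 0 := by have := hH (y + 1); linarith
      have h3 : T (y + 1) = 2 / 3 * T (y + 1 + 1) + 1 / 3 * T y := by
        apply mul_left_cancel₀ hD; linarith
      rw [pow_succ]; linarith
  have hval : ∀ y, y ≤ n → T y = T 0 + (T 1 - T 0) * 2 * escapeProb y := by
    intro y
    induction y with
    | zero => intro _; simp [escapeProb]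
    | succ y ih =>
      intro hy
      have h1 := ih (by omega)
      have h2 := hinc y hy
      unfold escapeProb at h1 ⊢
      rw [pow_succ]; linarith
  have h0 := hbd 0 (by simp)
  have hN := hbd n (by simp)
  have h1 := hval n le_rfl
  have h2 := hval x hx
  have hpos := escapeProb_pos hn
  have : T x = β 0 + (β n - β 0) * (escapeProb x / escapeProb n) := by
    rw [h2, ← hN, h1, h0]
    field_simp
    ring
  rw [← this]
  exact hs x hx

lemma stepAvg_geometric_le (hH : Admissible H) {z : ℝ} (hz0 : 0 ≤ z) (hz : z ≤ 26 / 25)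
    {v : ℕ → ℝ} {x : ℕ} (hv : 0 ≤ v x) (h1 : v (x + 1) = 3 / 4 * v x)
    (h2 : v (x - 1) = 4 / 3 * v x) : z * stepAvg H v x ≤ v x := by
  have := hH x
  unfold stepAvg
  rw [h1, h2]
  have e : H x * v x + (1 - H x) * (2 / 3 * (3 / 4 * v x) + 1 / 3 * (4 / 3 * v x))
      = (17 / 18 + H x / 18) * v x := by ring
  rw [e, ← mul_assoc]
  have : z * (17 / 18 + H x / 18) ≤ 1 := by nlinarith
  nlinarith

lemma exitProb_back_sum_le (hn : 0 < n) (hH : Admissible H) {z : ℝ} (hz0 : 0 ≤ z)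
    (hz : z ≤ 26 / 25) (hb0 : β 0 ≤ 1) (hbn : β n ≤ 0) (K : ℕ) :
    ∑ k ∈ range K, exitProb n H β k 1 * z ^ k ≤ 3 / 4 := by
  have := exitProb_sum_le (β := β) hH hz0 (v := fun x => (3 / 4 : ℝ) ^ x) (fun x => by positivity)
    (by simpa using hb0) (hbn.trans (by positivity)) (fun x hx _ => by
      refine stepAvg_geometric_le hH hz0 hz (by positivity) (by rw [pow_succ]; ring) ?_
      obtain ⟨y, rfl⟩ := Nat.exists_eq_succ_of_ne_zero hx.ne'
      simp only [Nat.succ_eq_add_one, Nat.add_sub_cancel, pow_succ]; ring) K 1 hn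
  simpa using this

lemma exitProb_last_sum_le (hn : 0 < n) (hH : Admissible H) {z : ℝ} (hz0 : 0 ≤ z)
    (hz : z ≤ 26 / 25) (hβ : ∀ x, β x ≤ 1) (K : ℕ) :
    ∑ k ∈ range K, exitProb n H β k (n - 1) * z ^ k ≤ 4 / 3 := by
  have := exitProb_sum_le (n := n) (β := β) hH hz0 (v := fun x => (4 / 3 : ℝ) ^ (n - x))
    (fun x => by positivity) ((hβ 0).trans (one_le_pow₀ (by norm_num)))
    (by simpa using hβ n) (fun x hx hxn => by
      have e : n - x = n - (x + 1) + 1 := by omega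
      have e' : n - (x - 1) = n - x + 1 := by omega
      refine stepAvg_geometric_le hH hz0 hz (by positivity) ?_ ?_
      · simp only [e, pow_succ]; ring
      · simp only [e', pow_succ]; ring) K (n - 1) (by omega)
  rwa [show n - (n - 1) = 1 by omega, pow_one] at this

/-- Mean time to move from `x` to `x + 1` for the walk conditioned to avoid `0`. -/
noncomputable def passageMean (H : ℕ → ℝ) : ℕ → ℝ
  | 0 => 0
  | x + 1 => (1 / (1 - H (x + 1)) * escapeProb (x + 1) + 1 / 3 * escapeProb x * passageMean H x) /
      (2 / 3 * escapeProb (x + 2))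

lemma escapeProb_nonneg (x : ℕ) : 0 ≤ escapeProb x := by
  unfold escapeProb
  have : ((1 : ℝ) / 2) ^ x ≤ 1 := pow_le_one₀ (by norm_num) (by norm_num)
  linarith

lemma escapeProb_le_succ (x : ℕ) : escapeProb x ≤ escapeProb (x + 1) := by
  unfold escapeProb
  rw [pow_succ]
  have : (0 : ℝ) ≤ (1 / 2) ^ x := by positivity
  linarith

lemma passageMean_bounds (hH : Admissible H) (x : ℕ) :
    0 ≤ passageMean H x ∧ passageMean H x ≤ 4 := by
  induction x with
  | zero => simp [passageMean]
  | succ x ih =>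
    rw [passageMean]
    have hx2 := escapeProb_pos (show 0 < x + 2 by omega)
    have h1 := escapeProb_le_succ (x + 1)
    have h0 := escapeProb_le_succ x
    have hn0 := escapeProb_nonneg x
    have hD := hH (x + 1)
    have hb : 1 / (1 - H (x + 1)) ≤ 4 / 3 := by
      rw [div_le_div_iff₀ (by linarith) (by norm_num)]; linarith
    have hb0 : 0 ≤ 1 / (1 - H (x + 1)) := by
      apply div_nonneg zero_le_one; linarith
    constructor
    · apply div_nonneg _ (by positivity)
      have := mul_nonneg hb0 (hn0.trans h0)
      have := mul_nonneg hn0 ih.1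
      linarith
    · rw [div_le_iff₀ (by positivity)]
      have e1 : 1 / (1 - H (x + 1)) * escapeProb (x + 1) ≤ 4 / 3 * escapeProb (x + 2) := by
        gcongr
        exact hn0.trans h0
      have e2 : escapeProb x * passageMean H x ≤ escapeProb (x + 2) * 4 := by
        gcongr
        · exact ih.1
        · exact h0.trans h1
        · exact ih.2
      linarith

lemma passageMean_balance (x : ℕ) :
    2 / 3 * escapeProb (x + 2) * passageMean H (x + 1) - 1 / 3 * escapeProb x * passageMean H x
      = 1 / (1 - H (x + 1)) * escapeProb (x + 1) := by
  have hx2 := escapeProb_pos (show 0 < x + 2 by omega)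
  rw [passageMean, mul_div_cancel₀ _ (by positivity)]
  ring

lemma passageMean_sum (N : ℕ) :
    ∑ x ∈ range N, passageMean H (x + 1)
      = 3 * ∑ x ∈ range N, 1 / (1 - H (x + 1)) * escapeProb (x + 1)
        - escapeProb N * passageMean H N := by
  induction N with
  | zero => simp [escapeProb]
  | succ N ih =>
    rw [sum_range_succ, sum_range_succ, ih, ← passageMean_balance]
    unfold escapeProb
    ring

lemma passageMean_sum_near (hH : Admissible H) (N : ℕ) :
    |∑ x ∈ range N, passageMean H (x + 1) - 3 * ∑ x ∈ range N, 1 / (1 - H (x + 1))| ≤ 8 := by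
  have hb : ∀ x, 0 ≤ 1 / (1 - H x) ∧ 1 / (1 - H x) ≤ 4 / 3 := by
    intro x
    have hD := hH x
    exact ⟨div_nonneg zero_le_one (by linarith), by
      rw [div_le_div_iff₀ (by linarith) (by norm_num)]; linarith⟩
  have h1 : ∑ x ∈ range N, 1 / (1 - H (x + 1)) - ∑ x ∈ range N, 1 / (1 - H (x + 1)) *
      escapeProb (x + 1) = ∑ x ∈ range N, 1 / (1 - H (x + 1)) * (1 / 2) ^ (x + 1) := by
    rw [← sum_sub_distrib]
    refine sum_congr rfl fun x _ => ?_
    unfold escapeProb; ring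
  have h2 : 0 ≤ ∑ x ∈ range N, 1 / (1 - H (x + 1)) * (1 / 2) ^ (x + 1) :=
    sum_nonneg fun x _ => mul_nonneg (hb _).1 (by positivity)
  have h3 : ∑ x ∈ range N, 1 / (1 - H (x + 1)) * (1 / 2) ^ (x + 1) ≤ 4 / 3 := by
    calc _ ≤ ∑ x ∈ range N, 2 / 3 * ((1 : ℝ) / 2) ^ x := by
          refine sum_le_sum fun x _ => ?_
          rw [pow_succ]
          have := (hb (x + 1)).2
          have hp : (0 : ℝ) ≤ (1 / 2) ^ x := by positivity
          nlinarith
      _ = 2 / 3 * ∑ x ∈ range N, ((1 : ℝ) / 2) ^ x := by rw [mul_sum]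
      _ ≤ 2 / 3 * 2 := by
          gcongr
          exact sum_geometric_two_le N
      _ = _ := by norm_num
  have h4 := passageMean_bounds hH N
  have h5 := escapeProb_nonneg N
  have h6 : escapeProb N ≤ 1 := by
    unfold escapeProb
    have : (0 : ℝ) ≤ (1 / 2) ^ N := by positivity
    linarith
  rw [passageMean_sum, abs_le]
  constructor <;> nlinarith [h4.1, h4.2]

lemma exp_le_quadratic {u : ℝ} (hu : |u| ≤ 1) : Real.exp u ≤ 1 + u + u ^ 2 := by
  have h := Real.abs_exp_sub_one_sub_id_le hu
  rw [abs_le] at h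
  linarith

lemma exitProb_forward_sum_le (hH : Admissible H) {s : ℝ} (hs : |s| ≤ 1 / 100)
    (hn : 0 < n) (hβ0 : β 0 = 0) (hβn : β n = 1) (K : ℕ) :
    ∑ k ∈ range K, exitProb n H β k 1 * Real.exp s ^ k ≤
      escapeProb 1 / escapeProb n *
        Real.exp (s * ∑ x ∈ range (n - 1), passageMean H (x + 1) + 100 * s ^ 2 * n) := by
  have hpos := escapeProb_pos hn
  set g : ℕ → ℝ := fun y => s * passageMean H y + 100 * s ^ 2 with hg
  set E : ℕ → ℝ := fun x => Real.exp (∑ y ∈ Ico x n, g y) with hE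
  have hs2 : s ^ 2 ≤ |s| * (1 / 100) := by
    rw [← sq_abs, pow_two]; gcongr
  have hgb : ∀ y, |g y| ≤ 5 * |s| := by
    intro y
    have hc := passageMean_bounds hH y
    calc |g y| ≤ |s * passageMean H y| + |100 * s ^ 2| := abs_add_le _ _
      _ = |s| * passageMean H y + 100 * s ^ 2 := by
        rw [abs_mul, abs_of_nonneg hc.1, abs_of_nonneg (by positivity : 0 ≤ 100 * s ^ 2)]
      _ ≤ |s| * 4 + 100 * (|s| * (1 / 100)) := by gcongr; exact hc.2
      _ = _ := by ring
  have hg1 : ∀ y, |g y| ≤ 1 := fun y => (hgb y).trans (by linarith)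
  have hg2 : ∀ y, g y ^ 2 ≤ 25 * s ^ 2 := by
    intro y
    rw [← sq_abs, ← sq_abs s]
    calc |g y| ^ 2 ≤ (5 * |s|) ^ 2 := by gcongr; exact hgb y
      _ = _ := by ring
  have hsuper : ∀ x, 0 < x → x < n →
      Real.exp s * stepAvg H (fun x => escapeProb x / escapeProb n * E x) x
        ≤ escapeProb x / escapeProb n * E x := by
    intro x hx hxn
    obtain ⟨y, rfl⟩ := Nat.exists_eq_succ_of_ne_zero hx.ne'
    simp only [Nat.succ_eq_add_one] at hxn ⊢
    have e1 : E (y + 1 + 1) = E (y + 1) * Real.exp (-g (y + 1)) := by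
      simp only [hE]
      rw [sum_eq_sum_Ico_succ_bot hxn, ← Real.exp_add]
      congr 1; ring
    have e0 : E y = E (y + 1) * Real.exp (g y) := by
      simp only [hE]
      rw [sum_eq_sum_Ico_succ_bot (show y < n by omega), ← Real.exp_add]
      congr 1; ring
    have hD := hH (y + 1)
    have hD0 : 0 < 1 - H (y + 1) := by linarith
    have b1 : Real.exp (-g (y + 1)) ≤ 1 - g (y + 1) + 25 * s ^ 2 := by
      have := exp_le_quadratic (u := -g (y + 1)) (by rw [abs_neg]; exact hg1 _)
      have := hg2 (y + 1)
      linarith [neg_sq (g (y + 1))]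
    have b0 : Real.exp (g y) ≤ 1 + g y + 25 * s ^ 2 := by
      have := exp_le_quadratic (hg1 y)
      have := hg2 y
      linarith
    have hbal := passageMean_balance (H := H) y
    have p0 := escapeProb_nonneg y
    have p1 := escapeProb_pos (show 0 < y + 1 by omega)
    have p2 := escapeProb_pos (show 0 < y + 2 by omega)
    have hsum1 : 2 / 3 * escapeProb (y + 2) + 1 / 3 * escapeProb y = escapeProb (y + 1) := by
      unfold escapeProb; ring
    have hdiff : 1 / 3 * escapeProb (y + 1) ≤ 2 / 3 * escapeProb (y + 2) - 1 / 3 * escapeProb y := by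
      linarith [escapeProb_le_succ (y + 1), escapeProb_le_succ y]
    have hmain : H (y + 1) * escapeProb (y + 1) + (1 - H (y + 1)) *
        (2 / 3 * (escapeProb (y + 2) * Real.exp (-g (y + 1)))
          + 1 / 3 * (escapeProb y * Real.exp (g y))) ≤ escapeProb (y + 1) * Real.exp (-s) := by
      calc _ ≤ H (y + 1) * escapeProb (y + 1) + (1 - H (y + 1)) *
            (2 / 3 * (escapeProb (y + 2) * (1 - g (y + 1) + 25 * s ^ 2))
            + 1 / 3 * (escapeProb y * (1 + g y + 25 * s ^ 2))) := by gcongr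
        _ = escapeProb (y + 1) + (1 - H (y + 1)) * (25 * s ^ 2 * escapeProb (y + 1)
              - s * (1 / (1 - H (y + 1)) * escapeProb (y + 1))
              - 100 * s ^ 2 * (2 / 3 * escapeProb (y + 2) - 1 / 3 * escapeProb y)) := by
            rw [← hbal]
            simp only [hg]
            linear_combination (1 - H (y + 1)) * (1 + 25 * s ^ 2) * hsum1
        _ ≤ escapeProb (y + 1) + (1 - H (y + 1)) * (25 * s ^ 2 * escapeProb (y + 1)
              - s * (1 / (1 - H (y + 1)) * escapeProb (y + 1))
              - 100 * s ^ 2 * (1 / 3 * escapeProb (y + 1))) := by gcongr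
        _ = escapeProb (y + 1) * (1 - s - (1 - H (y + 1)) * (25 / 3 * s ^ 2)) := by
            field_simp; ring
        _ ≤ escapeProb (y + 1) * (1 - s) := by
            have : 0 ≤ (1 - H (y + 1)) * (25 / 3 * s ^ 2) := by positivity
            apply mul_le_mul_of_nonneg_left _ p1.le
            linarith
        _ ≤ escapeProb (y + 1) * Real.exp (-s) := by
            gcongr
            linarith [Real.add_one_le_exp (-s)]
    unfold stepAvg
    simp only [Nat.add_sub_cancel]
    rw [e1, e0]
    have hEpos : 0 < E (y + 1) := Real.exp_pos _
    calc _ = Real.exp s * (E (y + 1) / escapeProb n) * (H (y + 1) * escapeProb (y + 1) +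
          (1 - H (y + 1)) * (2 / 3 * (escapeProb (y + 2) * Real.exp (-g (y + 1)))
          + 1 / 3 * (escapeProb y * Real.exp (g y)))) := by ring
      _ ≤ Real.exp s * (E (y + 1) / escapeProb n) * (escapeProb (y + 1) * Real.exp (-s)) := by
          gcongr
      _ = (Real.exp s * Real.exp (-s)) * (E (y + 1) / escapeProb n * escapeProb (y + 1)) := by ring
      _ = _ := by rw [← Real.exp_add]; simp; ring
  have h := exitProb_sum_le (β := β) hH (Real.exp_pos s).le
    (v := fun x => escapeProb x / escapeProb n * E x)
    (fun x => mul_nonneg (div_nonneg (escapeProb_nonneg x) hpos.le) (Real.exp_pos _).le)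
    (by simp [hβ0, escapeProb]) (by simp [hβn, hE, hpos.ne']) hsuper K 1 hn
  refine h.trans ?_
  have h1 := escapeProb_nonneg 1
  simp only [hE]
  gcongr
  rw [sum_Ico_eq_sum_range]
  simp only [hg, sum_add_distrib, ← mul_sum, sum_const, card_range, nsmul_eq_mul]
  simp only [add_comm 1]
  have : ((n - 1 : ℕ) : ℝ) ≤ n := by exact_mod_cast Nat.sub_le n 1
  nlinarith [sq_nonneg s]

end

lemma goldenRatio_bounds : 1.618 < Real.goldenRatio ∧ Real.goldenRatio < 1.6181 := by
  unfold Real.goldenRatio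
  constructor
  · have : (2.236 : ℝ) < √5 := Real.lt_sqrt_of_sq_lt (by norm_num)
    linarith
  · have : √5 < (2.2362 : ℝ) := by rw [Real.sqrt_lt' (by norm_num)]; norm_num
    linarith

lemma goldenConj_eq : Real.goldenConj = 1 - Real.goldenRatio := by
  linarith [Real.goldenRatio_add_goldenConj]

/-- Simultaneous approximation of a real number and a second real number by an element of `ℤ[φ]`
and its conjugate, at the scales `φ ^ (-j)` and `φ ^ j`. -/
lemma exists_golden_integer_near (j : ℕ) : ∀ X Y : ℝ, ∃ p q : ℤ,
    |p + q * Real.goldenRatio - X| * Real.goldenRatio ^ j ≤ 2 ∧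
    |p + q * Real.goldenConj - Y| ≤ 2 * Real.goldenRatio ^ j := by
  have hb := goldenRatio_bounds
  have hφ := Real.goldenRatio_sq
  have hc := goldenConj_eq
  set φ := Real.goldenRatio
  set ψ := Real.goldenConj
  have hφ0 : 0 < φ := by linarith
  have hφψ : φ * ψ = -1 := Real.goldenRatio_mul_goldenConj
  induction j with
  | zero =>
    intro X Y
    have hs : 0 < 2 * φ - 1 := by linarith
    set q : ℤ := round ((X - Y) / (2 * φ - 1))
    set p : ℤ := round (X - q * φ)
    have h1 : |(X - q * φ) - p| ≤ 1 / 2 := abs_sub_round _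
    have h2 : |(X - Y) / (2 * φ - 1) - q| ≤ 1 / 2 := abs_sub_round _
    have h3 : |X - Y - q * (2 * φ - 1)| ≤ 1 / 2 * (2 * φ - 1) := by
      rw [show X - Y - q * (2 * φ - 1) = ((X - Y) / (2 * φ - 1) - q) * (2 * φ - 1) by
        field_simp, abs_mul, abs_of_pos hs]
      gcongr
    refine ⟨p, q, ?_, ?_⟩
    · rw [abs_le] at h1
      rw [pow_zero, mul_one, abs_le]; constructor <;> linarith
    · rw [abs_le] at h1 h3
      rw [pow_zero, mul_one, abs_le, hc]; constructor <;> linarith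
  | succ j ih =>
    intro X Y
    obtain ⟨p, q, h1, h2⟩ := ih (X * φ) (Y * ψ)
    refine ⟨q - p, p, ?_, ?_⟩
    · calc _ = |p + q * φ - X * φ| * φ ^ j := by
            rw [show (p : ℝ) + q * φ - X * φ = (((q - p : ℤ) : ℝ) + p * φ - X) * φ by
              push_cast; linear_combination (-p : ℝ) * hφ, abs_mul, abs_of_pos hφ0]
            ring
        _ ≤ 2 := h1
    · have e : (((q - p : ℤ) : ℝ) + p * ψ - Y) = -φ * (p + q * ψ - Y * ψ) := by
        push_cast
        rw [hc] at hφψ ⊢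
        linear_combination (q - Y : ℝ) * hφψ
      rw [e, abs_mul, abs_neg, abs_of_pos hφ0, pow_succ]
      nlinarith

/-- Every real `τ` is within `O(1/Q)` of a value of the form `(3/4)((3+φ)k₁ + 4k₂)` with
`k₁ - k₂ = O(Q)`. -/
lemma exists_loop_counts_near (Q τ : ℝ) (hQ : 1 ≤ Q) : ∃ k₁ k₂ : ℤ,
    |3 / 4 * (3 + Real.goldenRatio) * k₁ + 3 * k₂ - τ| ≤ 12 / Q ∧
    |(k₁ : ℝ) - k₂| ≤ 30 * Q := by
  have hb := goldenRatio_bounds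
  have hc := goldenConj_eq
  obtain ⟨j, hj1, hj2⟩ := exists_nat_pow_near hQ Real.one_lt_goldenRatio
  obtain ⟨p, q, h1, h2⟩ := exists_golden_integer_near j (τ / 3)
    (τ / 3 - τ / 3 * ((2 * Real.goldenRatio - 1) / (7 + Real.goldenRatio)))
  rw [hc] at h2
  set φ := Real.goldenRatio
  set X := τ / 3
  set Y := X - X * ((2 * φ - 1) / (7 + φ)) with hY
  have hQ0 : 0 < Q := by linarith
  have h1' : |p + q * φ - X| ≤ 4 / Q := by
    rw [le_div_iff₀ hQ0]
    have h0 := abs_nonneg (p + q * φ - X)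
    have hjp : 0 < φ ^ j := by positivity
    have : Q ≤ 2 * φ ^ j := by
      rw [pow_succ] at hj2; nlinarith
    nlinarith
  refine ⟨4 * q, p - 3 * q, ?_, ?_⟩
  · have e : 3 / 4 * (3 + φ) * ((4 * q : ℤ) : ℝ) + 3 * ((p - 3 * q : ℤ) : ℝ) - τ
        = 3 * (p + q * φ - X) := by
      push_cast; simp only [X]; ring
    rw [e, abs_mul, abs_of_pos (by norm_num : (0 : ℝ) < 3)]
    calc _ ≤ 3 * (4 / Q) := by gcongr
      _ = _ := by ring
  · have hs : 0 < 2 * φ - 1 := by linarith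
    have e : (((4 * q : ℤ) : ℝ) - ((p - 3 * q : ℤ) : ℝ)) * (2 * φ - 1)
        = (7 + φ) * ((p + q * φ - X) - (p + q * (1 - φ) - Y))
          - (p + q * φ - X) * (2 * φ - 1) := by
      push_cast
      rw [hY]
      have : 7 + φ ≠ 0 := by linarith
      field_simp
      ring
    have h4 : 4 / Q ≤ 4 := by rw [div_le_iff₀ hQ0]; linarith
    have h5 : |p + q * (1 - φ) - Y| ≤ 2 * Q := h2.trans (by linarith)
    have hx : |p + q * φ - X| ≤ 4 := h1'.trans h4
    generalize (p : ℝ) + q * φ - X = x at *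
    generalize (p : ℝ) + q * (1 - φ) - Y = y at *
    generalize (((4 * q : ℤ) : ℝ) - ((p - 3 * q : ℤ) : ℝ)) = d at *
    have h6 : |d| * (2 * φ - 1) ≤ 30 * Q * (2 * φ - 1) := by
      rw [← abs_of_pos hs, ← abs_mul, e, abs_of_pos hs]
      rw [abs_le] at hx h5
      rw [abs_le]
      constructor <;> nlinarith
    exact le_of_mul_le_mul_right h6 hs

/-- Bad approximability: distinct pairs of loop counts are separated at every scale `Q`. -/
lemma loop_counts_separated (Q : ℝ) (hQ : 1 ≤ Q) (d₁ d₂ : ℤ)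
    (h1 : |3 / 4 * (3 + Real.goldenRatio) * d₁ + 3 * d₂| * Q < 1 / 4)
    (h2 : |(d₁ : ℝ) - d₂| < Q / 4) : d₁ = 0 ∧ d₂ = 0 := by
  have hb := goldenRatio_bounds
  have hφ := Real.goldenRatio_sq
  have hirr := Real.goldenRatio_irrational
  set φ := Real.goldenRatio
  set A : ℝ := (3 + φ) * d₁ + 4 * d₂ with hA
  set B : ℝ := (4 - φ) * d₁ + 4 * d₂ with hB
  have hA1 : |A| * Q < 1 / 3 := by
    have e : 3 / 4 * (3 + φ) * d₁ + 3 * d₂ = 3 / 4 * A := by rw [hA]; ring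
    rw [e, abs_mul, abs_of_pos (by norm_num : (0 : ℝ) < 3 / 4)] at h1
    linarith
  have hA2 : |A| ≤ 1 / 3 := by nlinarith [abs_nonneg A]
  have hd1 : (d₁ : ℝ) * (7 + φ) = A + 4 * (d₁ - d₂) := by rw [hA]; ring
  have hB1 : |B| ≤ 1 + Q := by
    have e : B * (7 + φ) = A * (7 + φ) - (2 * φ - 1) * (A + 4 * (d₁ - d₂)) := by
      rw [← hd1, hA, hB]; ring
    have : |B| * (7 + φ) ≤ (1 + Q) * (7 + φ) := by
      rw [← abs_of_pos (by linarith : 0 < 7 + φ), ← abs_mul, e, abs_of_pos (by linarith : 0 < 7 + φ)]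
      generalize (d₁ : ℝ) - d₂ = d at *
      rw [abs_le] at hA2
      rw [abs_lt] at h2
      rw [abs_le]
      constructor <;> nlinarith
    exact le_of_mul_le_mul_right this (by linarith)
  have hAB : A * B = (((3 * d₁ + 4 * d₂) ^ 2 + (3 * d₁ + 4 * d₂) * d₁ - d₁ ^ 2 : ℤ) : ℝ) := by
    rw [hA, hB]; push_cast
    linear_combination (-(d₁ : ℝ) ^ 2) * hφ
  have hlt : |A * B| < 1 := by
    rw [abs_mul]
    nlinarith [abs_nonneg A, abs_nonneg B, mul_le_mul_of_nonneg_left hB1 (abs_nonneg A)]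
  rw [hAB] at hlt
  have hz : ((3 * d₁ + 4 * d₂) ^ 2 + (3 * d₁ + 4 * d₂) * d₁ - d₁ ^ 2 : ℤ) = 0 := by
    rw [← Int.abs_lt_one_iff]; exact_mod_cast hlt
  rw [hz] at hAB
  have hzero : ∀ a b : ℤ, (a : ℝ) + b * φ = 0 → b = 0 := by
    intro a b hab
    by_contra hne
    have := (irrational_intCast_add_iff (m := a)).2 ((irrational_intCast_mul_iff (m := b)).2 ⟨hne, hirr⟩)
    rw [hab] at this
    exact this ⟨0, by simp⟩
  have hd : d₁ = 0 := by
    rcases mul_eq_zero.1 (hAB.trans (by simp)) with h | h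
    · exact hzero (3 * d₁ + 4 * d₂) d₁ (by push_cast; rw [hA] at h; linarith)
    · have := hzero (4 * d₁ + 4 * d₂) (-d₁) (by push_cast; rw [hB] at h; linarith)
      omega
  refine ⟨hd, ?_⟩
  subst hd
  simp at hz
  exact hz

lemma NonnegEval.X_mul_mk {z B : ℝ} {f : ℕ → ℝ} (hz : 0 ≤ z) (hf : ∀ k, 0 ≤ f k)
    (h : HasSum (fun k => f k * z ^ k) B) :
    NonnegEval z (PowerSeries.X * PowerSeries.mk f) (z * B) := by
  have hX : NonnegEval z (PowerSeries.X : PowerSeries ℝ) z := by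
    refine ⟨fun k => ?_, ?_⟩
    · rw [PowerSeries.coeff_X]; split_ifs <;> norm_num
    · convert hasSum_ite_eq (1 : ℕ) z using 2 with k
      rw [PowerSeries.coeff_X]
      split_ifs with h <;> simp [h]
  exact hX.mul hz ⟨by simpa using hf, by simpa using h⟩

lemma NonnegEval.exists_X_mul_mk_le {z B : ℝ} {f : ℕ → ℝ} (hz : 0 ≤ z) (hf : ∀ k, 0 ≤ f k)
    (h : ∀ K, ∑ k ∈ range K, f k * z ^ k ≤ B) :
    ∃ D ≤ z * B, NonnegEval z (PowerSeries.X * PowerSeries.mk f) D := by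
  have hnn : ∀ k, 0 ≤ f k * z ^ k := fun k => mul_nonneg (hf k) (pow_nonneg hz k)
  have hs := summable_of_sum_range_le hnn h
  exact ⟨_, mul_le_mul_of_nonneg_left (hs.tsum_le_of_sum_range_le h) hz,
    NonnegEval.X_mul_mk hz hf hs.hasSum⟩

/-- Enlarging the evaluation point of a power series convergent at `exp η`, by convexity. -/
lemma NonnegEval.exists_exp_le {f : PowerSeries ℝ} {B D η s : ℝ} (hη : 0 < η) (hs0 : 0 ≤ s)
    (hs : s ≤ η) (h1 : NonnegEval 1 f B) (hE : NonnegEval (Real.exp η) f D) :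
    ∃ A ≤ B + s / η * D, NonnegEval (Real.exp s) f A := by
  have hc : ∀ k : ℕ, Real.exp s ^ k ≤ 1 + s / η * Real.exp η ^ k := by
    intro k
    have hθ : s / η ≤ 1 := (div_le_one hη).2 hs
    have hθ0 : 0 ≤ s / η := by positivity
    have := convexOn_exp.2 (Set.mem_univ (0 : ℝ)) (Set.mem_univ ((k : ℝ) * η))
      (sub_nonneg.2 hθ) hθ0 (by ring)
    simp only [smul_eq_mul, mul_zero, zero_add, Real.exp_zero, mul_one] at this
    rw [← Real.exp_nat_mul, ← Real.exp_nat_mul]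
    rw [show s / η * (k * η) = k * s by field_simp] at this
    linarith
  have hle : ∀ k, PowerSeries.coeff k f * Real.exp s ^ k ≤
      PowerSeries.coeff k f * 1 ^ k + s / η * (PowerSeries.coeff k f * Real.exp η ^ k) := by
    intro k
    have := mul_le_mul_of_nonneg_left (hc k) (h1.1 k)
    rw [one_pow]; linarith
  have hsum := h1.2.add (hE.2.mul_left (s / η))
  have hS := Summable.of_nonneg_of_le
    (fun k => mul_nonneg (h1.1 k) (pow_nonneg (Real.exp_pos s).le k)) hle hsum.summable
  exact ⟨_, hasSum_le hle hS.hasSum hsum, h1.1, hS.hasSum⟩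

lemma NonnegEval.exists_le_of_le {f : PowerSeries ℝ} {B z w : ℝ} (hz : 0 ≤ z) (hzw : z ≤ w)
    (h : NonnegEval w f B) : ∃ A ≤ B, NonnegEval z f A := by
  have hle : ∀ k, PowerSeries.coeff k f * z ^ k ≤ PowerSeries.coeff k f * w ^ k := fun k =>
    mul_le_mul_of_nonneg_left (pow_le_pow_left₀ hz hzw k) (h.1 k)
  have hS := Summable.of_nonneg_of_le
    (fun k => mul_nonneg (h.1 k) (pow_nonneg hz k)) hle h.2.summable
  exact ⟨_, hasSum_le hle hS.hasSum h.2, h.1, hS.hasSum⟩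

/-- Generating function of excursions from `o` that wind once around a cycle. -/
noncomputable def windSeries (n : ℕ) (H : ℕ → ℝ) : PowerSeries ℝ :=
  PowerSeries.X * PowerSeries.mk
    fun k => 1 / 3 * exitProb n H (fun x => if x = n then 1 else 0) k 1

/-- Generating function of the remaining excursions from `o` into a cycle: those that start
forwards and backtrack, and those that start backwards. -/
noncomputable def shortSeries (n : ℕ) (H : ℕ → ℝ) : PowerSeries ℝ :=
  PowerSeries.X * PowerSeries.mk
    fun k => 1 / 3 * exitProb n H (fun x => if x = n then 0 else 1) k 1
      + 1 / 6 * exitProb n H (fun _ => 1) k (n - 1)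

/-- Probability of an excursion from `o` that winds around a given cycle. -/
noncomputable def windProb (n : ℕ) : ℝ := 1 / 3 * (escapeProb 1 / escapeProb n)

/-- Generating function of the walks `o → o` that never wind around a cycle. -/
noncomputable def shortGreen (n : ℕ) (H₁ H₂ : ℕ → ℝ) : PowerSeries ℝ :=
  (1 - (shortSeries n H₁ + shortSeries n H₂))⁻¹

/-- Generating function of the walks `o → o` that wind `k₁` times around the first cycle and `k₂`
times around the second cycle, in a fixed order. -/
noncomputable def windGreen (n : ℕ) (H₁ H₂ : ℕ → ℝ) (k₁ k₂ : ℕ) : PowerSeries ℝ :=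
  shortGreen n H₁ H₂ * (windSeries n H₁ * shortGreen n H₁ H₂) ^ k₁
    * (windSeries n H₂ * shortGreen n H₁ H₂) ^ k₂

section
variable {n : ℕ} {H H₁ H₂ : ℕ → ℝ}

lemma windProb_bounds (hn : 2 ≤ n) : 1 / 6 ≤ windProb n ∧ windProb n ≤ 2 / 9 := by
  unfold windProb escapeProb
  have h : ((1 : ℝ) / 2) ^ n ≤ (1 / 2) ^ 2 :=
    pow_le_pow_of_le_one (by norm_num) (by norm_num) hn
  norm_num at h ⊢
  have h' : ((1 : ℝ) / 2) ^ n ≤ 1 / 4 := by simpa using h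
  have h0 : (0 : ℝ) < (1 / 2) ^ n := by simp
  have hpos : 0 < 1 - ((1 : ℝ) / 2) ^ n := by linarith
  constructor
  · have : 1 / 2 ≤ 1 / 2 / (1 - ((1 : ℝ) / 2) ^ n) := by
      rw [le_div_iff₀ hpos]; linarith
    linarith
  · have : 1 / 2 / (1 - ((1 : ℝ) / 2) ^ n) ≤ 2 / 3 := by
      rw [div_le_iff₀ hpos]; linarith
    linarith

lemma windSeries_eval_one (hn : 0 < n) (hH : Admissible H) :
    NonnegEval 1 (windSeries n H) (windProb n) := by
  have h := exitProb_hasSum (β := fun x => if x = n then 1 else 0) hn hH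
    (fun x => by positivity) (fun x => by split_ifs <;> norm_num) hn
  have := NonnegEval.X_mul_mk (z := 1) (f := fun k => 1 / 3 * exitProb n H
    (fun x => if x = n then 1 else 0) k 1) zero_le_one
    (fun k => mul_nonneg (by norm_num) (exitProb_nonneg hH (fun x => by positivity) _ _))
    (by simp only [one_pow, mul_one]; exact h.mul_left (1 / 3))
  simpa [windSeries, windProb, hn.ne] using this

lemma windSeries_eval_exp_le (hn : 0 < n) (hH : Admissible H) {s : ℝ} (hs : |s| ≤ 1 / 100) :
    ∃ B ≤ windProb n * Real.exp (s * (1 + ∑ x ∈ range (n - 1), passageMean H (x + 1))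
        + 100 * s ^ 2 * n), NonnegEval (Real.exp s) (windSeries n H) B := by
  obtain ⟨B, hB, hE⟩ := NonnegEval.exists_X_mul_mk_le (z := Real.exp s)
    (f := fun k => 1 / 3 * exitProb n H (fun x => if x = n then 1 else 0) k 1)
    (Real.exp_pos s).le
    (fun k => mul_nonneg (by norm_num) (exitProb_nonneg hH (fun x => by positivity) _ _))
    (B := 1 / 3 * (escapeProb 1 / escapeProb n *
        Real.exp (s * ∑ x ∈ range (n - 1), passageMean H (x + 1) + 100 * s ^ 2 * n)))
    (fun K => by
      simp only [mul_assoc, ← mul_sum]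
      gcongr
      have := exitProb_forward_sum_le (β := fun x => if x = n then 1 else 0) hH hs hn
        (by simp [hn.ne]) (by simp) K
      simpa only [mul_assoc] using this)
  refine ⟨B, hB.trans_eq ?_, hE⟩
  rw [windProb, show s * (1 + ∑ x ∈ range (n - 1), passageMean H (x + 1)) + 100 * s ^ 2 * n
    = s + (s * ∑ x ∈ range (n - 1), passageMean H (x + 1) + 100 * s ^ 2 * n) by ring,
    Real.exp_add s]
  ring

lemma shortSeries_coeff_nonneg (hH : Admissible H) (k : ℕ) :
    0 ≤ 1 / 3 * exitProb n H (fun x => if x = n then 0 else 1) k 1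
      + 1 / 6 * exitProb n H (fun _ => 1) k (n - 1) := by
  have h1 := exitProb_nonneg (n := n) hH (β := fun x => if x = n then 0 else 1)
    (fun x => by positivity) k 1
  have h2 := exitProb_nonneg (n := n) hH (β := fun _ => 1) (fun x => by norm_num) k (n - 1)
  positivity

lemma shortSeries_eval_one (hn : 0 < n) (hH : Admissible H) :
    NonnegEval 1 (shortSeries n H) (1 / 2 - windProb n) := by
  have h1 := exitProb_hasSum (β := fun x => if x = n then 0 else 1) hn hH
    (fun x => by positivity) (fun x => by split_ifs <;> norm_num) hn
  have h2 := exitProb_hasSum (β := fun _ => 1) hn hH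
    (fun x => by norm_num) (fun x => by norm_num) (Nat.sub_le n 1)
  have := NonnegEval.X_mul_mk (z := 1) zero_le_one (shortSeries_coeff_nonneg (n := n) hH)
    (by simp only [one_pow, mul_one]; exact (h1.mul_left (1 / 3)).add (h2.mul_left (1 / 6)))
  have e : 1 / 2 - windProb n = 1 * (1 / 3 * ((if 0 = n then 0 else 1) + ((if n = n then 0 else 1)
      - (if 0 = n then 0 else 1)) * (escapeProb 1 / escapeProb n))
      + 1 / 6 * (1 + (1 - 1) * (escapeProb (n - 1) / escapeProb n))) := by
    simp only [windProb, hn.ne, if_false, if_true]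
    ring
  rw [e]
  exact this

lemma shortSeries_eval_exp_le (hn : 0 < n) (hH : Admissible H) :
    ∃ B ≤ (1 : ℝ) / 2, NonnegEval (Real.exp (1 / 26)) (shortSeries n H) B := by
  have hz : Real.exp (1 / 26) ≤ 26 / 25 := by
    have := Real.add_one_le_exp (-(1 / 26 : ℝ))
    have h1 : Real.exp (1 / 26) * Real.exp (-(1 / 26)) = 1 := by rw [← Real.exp_add]; simp
    nlinarith [Real.exp_pos (1 / 26)]
  have hz0 := (Real.exp_pos (1 / 26)).le
  obtain ⟨B, hB, hE⟩ := NonnegEval.exists_X_mul_mk_le hz0 (shortSeries_coeff_nonneg (n := n) hH)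
    (B := 1 / 3 * (3 / 4) + 1 / 6 * (4 / 3)) (fun K => by
      simp only [add_mul, sum_add_distrib, mul_assoc, ← mul_sum]
      gcongr
      · exact exitProb_back_sum_le hn hH hz0 hz (by simp [hn.ne]) (by simp) K
      · exact exitProb_last_sum_le hn hH hz0 hz (fun _ => le_rfl) K)
  exact ⟨B, by linarith, hE⟩

lemma X_dvd_shortSeries_add : PowerSeries.X ∣ shortSeries n H₁ + shortSeries n H₂ :=
  dvd_add (Dvd.intro _ rfl) (Dvd.intro _ rfl)

lemma shortGreen_eval_one (hn : 2 ≤ n) (hH₁ : Admissible H₁) (hH₂ : Admissible H₂) :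
    NonnegEval 1 (shortGreen n H₁ H₂) (1 / (2 * windProb n)) := by
  have hw := windProb_bounds hn
  have hn0 : 0 < n := by omega
  have := NonnegEval.one_sub_inv zero_le_one X_dvd_shortSeries_add
    ((shortSeries_eval_one hn0 hH₁).add (shortSeries_eval_one hn0 hH₂)) (by linarith)
  rwa [show 1 - (1 / 2 - windProb n + (1 / 2 - windProb n)) = 2 * windProb n by ring] at this

lemma shortGreen_eval_exp_le (hn : 2 ≤ n) (hH₁ : Admissible H₁) (hH₂ : Admissible H₂) {s : ℝ}
    (hs : |s| ≤ 1 / 156) :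
    ∃ B ≤ 1 / (2 * windProb n) * Real.exp (156 * |s|),
      NonnegEval (Real.exp s) (shortGreen n H₁ H₂) B := by
  have hw := windProb_bounds hn
  have hw0 : 0 < windProb n := by linarith
  rcases le_total s 0 with h0 | h0
  · obtain ⟨B, hB, hE⟩ := (shortGreen_eval_one hn hH₁ hH₂).exists_le_of_le (Real.exp_pos s).le
      (Real.exp_le_one_iff.2 h0)
    exact ⟨B, hB.trans (le_mul_of_one_le_right (by positivity)
      (Real.one_le_exp (by positivity))), hE⟩
  · rw [abs_of_nonneg h0] at hs ⊢
    have hn0 : 0 < n := by omega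
    obtain ⟨B₁, hB₁, hE₁⟩ := shortSeries_eval_exp_le hn0 hH₁
    obtain ⟨B₂, hB₂, hE₂⟩ := shortSeries_eval_exp_le hn0 hH₂
    obtain ⟨A, hA, hE⟩ := NonnegEval.exists_exp_le (by norm_num) h0 (by linarith)
      ((shortSeries_eval_one hn0 hH₁).add (shortSeries_eval_one hn0 hH₂)) (hE₁.add hE₂)
    have hA' : A ≤ 1 - 2 * windProb n * (1 - 78 * s) := by
      have : s / (1 / 26) * (B₁ + B₂) ≤ s / (1 / 26) * 1 := by gcongr; linarith
      nlinarith
    have hpos : 0 < 2 * windProb n * (1 - 78 * s) := by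
      apply mul_pos (by positivity); linarith
    refine ⟨_, ?_, NonnegEval.one_sub_inv (Real.exp_pos s).le X_dvd_shortSeries_add hE
      (by linarith)⟩
    calc 1 / (1 - A) ≤ 1 / (2 * windProb n * (1 - 78 * s)) := by gcongr; linarith
      _ = 1 / (2 * windProb n) * (1 / (1 - 78 * s)) := by rw [one_div_mul_one_div]
      _ ≤ _ := by
        gcongr
        rw [div_le_iff₀ (by linarith)]
        have := Real.add_one_le_exp (156 * s)
        nlinarith

lemma windGreen_eval_one (hn : 2 ≤ n) (hH₁ : Admissible H₁) (hH₂ : Admissible H₂) (k₁ k₂ : ℕ) :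
    NonnegEval 1 (windGreen n H₁ H₂ k₁ k₂)
      (1 / (2 * windProb n) * (1 / 2) ^ k₁ * (1 / 2) ^ k₂) := by
  have hw := windProb_bounds hn
  have hw0 : 0 < windProb n := by linarith
  have hR := shortGreen_eval_one hn hH₁ hH₂
  have e : (1 / 2 : ℝ) = windProb n * (1 / (2 * windProb n)) := by field_simp
  rw [e]
  exact (hR.mul zero_le_one (((windSeries_eval_one (by omega) hH₁).mul zero_le_one hR).pow
    zero_le_one k₁)).mul zero_le_one (((windSeries_eval_one (by omega) hH₂).mul zero_le_one hR).pow
    zero_le_one k₂)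

lemma windSeries_mul_shortGreen_eval_exp_le (hn : 2 ≤ n) (hH : Admissible H)
    (hH₁ : Admissible H₁) (hH₂ : Admissible H₂) {s a D : ℝ} (hs : |s| ≤ 1 / 156)
    (ha : |3 * ∑ x ∈ range (n - 1), 1 / (1 - H (x + 1)) - a * n| ≤ D) :
    ∃ B ≤ 1 / 2 * Real.exp (s * (a * n) + (165 + D) * |s| + 100 * s ^ 2 * n),
      NonnegEval (Real.exp s) (windSeries n H * shortGreen n H₁ H₂) B := by
  have hw := windProb_bounds hn
  have hw0 : 0 < windProb n := by linarith
  have hz := (Real.exp_pos s).le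
  obtain ⟨A, hA, hEA⟩ := windSeries_eval_exp_le (n := n) (by omega) hH (hs.trans (by norm_num))
  obtain ⟨B, hB, hEB⟩ := shortGreen_eval_exp_le hn hH₁ hH₂ hs
  refine ⟨A * B, ?_, hEA.mul hz hEB⟩
  have hm : s * (1 + ∑ x ∈ range (n - 1), passageMean H (x + 1)) ≤ s * (a * n) + (9 + D) * |s| := by
    have h8 := passageMean_sum_near hH (n - 1)
    have : |1 + ∑ x ∈ range (n - 1), passageMean H (x + 1) - a * n| ≤ 9 + D := by
      rw [abs_le] at *
      constructor <;> linarith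
    have h := (le_abs_self _).trans_eq
      (abs_mul s (1 + ∑ x ∈ range (n - 1), passageMean H (x + 1) - a * n))
    have := mul_le_mul_of_nonneg_left this (abs_nonneg s)
    linarith
  calc A * B ≤ (windProb n * Real.exp (s * (1 + ∑ x ∈ range (n - 1), passageMean H (x + 1))
        + 100 * s ^ 2 * n)) * (1 / (2 * windProb n) * Real.exp (156 * |s|)) :=
        mul_le_mul hA hB (hEB.nonneg hz) (by positivity)
    _ = 1 / 2 * Real.exp (s * (1 + ∑ x ∈ range (n - 1), passageMean H (x + 1))
        + 100 * s ^ 2 * n + 156 * |s|) := by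
        rw [Real.exp_add _ (156 * |s|)]; field_simp
    _ ≤ _ := by
        gcongr 1 / 2 * Real.exp ?_
        linarith

lemma windGreen_sum_exp_le (hn : 2 ≤ n) (hH₁ : Admissible H₁) (hH₂ : Admissible H₂)
    {s a₁ a₂ D : ℝ} (hs : |s| ≤ 1 / 156)
    (ha₁ : |3 * ∑ x ∈ range (n - 1), 1 / (1 - H₁ (x + 1)) - a₁ * n| ≤ D)
    (ha₂ : |3 * ∑ x ∈ range (n - 1), 1 / (1 - H₂ (x + 1)) - a₂ * n| ≤ D) (k₁ k₂ K : ℕ) :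
    ∑ k ∈ range K, PowerSeries.coeff k (windGreen n H₁ H₂ k₁ k₂) * Real.exp (s * k) ≤
      9 * (1 / 2) ^ (k₁ + k₂) * Real.exp (s * (n * (a₁ * k₁ + a₂ * k₂))
        + (k₁ + k₂) * ((165 + D) * |s| + 100 * s ^ 2 * n)) := by
  have hw := windProb_bounds hn
  have hz := (Real.exp_pos s).le
  obtain ⟨A, hA, hEA⟩ := shortGreen_eval_exp_le hn hH₁ hH₂ hs
  obtain ⟨B₁, hB₁, hE₁⟩ := windSeries_mul_shortGreen_eval_exp_le hn hH₁ hH₁ hH₂ hs ha₁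
  obtain ⟨B₂, hB₂, hE₂⟩ := windSeries_mul_shortGreen_eval_exp_le hn hH₂ hH₁ hH₂ hs ha₂
  have hE := (hEA.mul hz (hE₁.pow hz k₁)).mul hz (hE₂.pow hz k₂)
  have hA9 : A ≤ 9 := by
    refine hA.trans ?_
    have h1 : 1 / (2 * windProb n) ≤ 3 := by
      rw [div_le_iff₀ (by linarith)]; linarith
    have h2 : Real.exp (156 * |s|) ≤ 3 :=
      (Real.exp_le_exp.2 (by linarith : 156 * |s| ≤ 1)).trans
        (Real.exp_one_lt_d9.le.trans (by norm_num))
    calc _ ≤ (3 : ℝ) * 3 := by gcongr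
      _ = 9 := by norm_num
  have hb₁ := hE₁.nonneg hz
  have hb₂ := hE₂.nonneg hz
  calc ∑ k ∈ range K, PowerSeries.coeff k (windGreen n H₁ H₂ k₁ k₂) * Real.exp (s * k)
      = ∑ k ∈ range K, PowerSeries.coeff k (windGreen n H₁ H₂ k₁ k₂) * Real.exp s ^ k := by
        simp only [← Real.exp_nat_mul, mul_comm s]
    _ ≤ A * B₁ ^ k₁ * B₂ ^ k₂ := hE.sum_range_le hz K
    _ ≤ 9 * (1 / 2 * Real.exp (s * (a₁ * n) + (165 + D) * |s| + 100 * s ^ 2 * n)) ^ k₁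
        * (1 / 2 * Real.exp (s * (a₂ * n) + (165 + D) * |s| + 100 * s ^ 2 * n)) ^ k₂ := by
        gcongr
    _ = _ := by
        rw [mul_pow, mul_pow, ← Real.exp_nat_mul, ← Real.exp_nat_mul, pow_add]
        rw [show s * (n * (a₁ * k₁ + a₂ * k₂)) + (k₁ + k₂) * ((165 + D) * |s| + 100 * s ^ 2 * n)
          = k₁ * (s * (a₁ * n) + (165 + D) * |s| + 100 * s ^ 2 * n)
            + k₂ * (s * (a₂ * n) + (165 + D) * |s| + 100 * s ^ 2 * n) by ring, Real.exp_add]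
        ring

lemma X_pow_dvd_windSeries (hn : 0 < n) : PowerSeries.X ^ n ∣ windSeries n H := by
  obtain ⟨m, rfl⟩ := Nat.exists_eq_succ_of_ne_zero hn.ne'
  rw [Nat.succ_eq_add_one, pow_succ']
  refine mul_dvd_mul_left _ (PowerSeries.X_pow_dvd_iff.2 fun k hk => ?_)
  rw [PowerSeries.coeff_mk, exitProb_eq_zero_of_lt (fun x hx => by simp [hx.ne]) k 1 (by omega),
    mul_zero]

lemma coeff_windGreen_eq_zero (hn : 0 < n) {k₁ k₂ k : ℕ} (hk : k < n * (k₁ + k₂)) :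
    PowerSeries.coeff k (windGreen n H₁ H₂ k₁ k₂) = 0 := by
  refine PowerSeries.X_pow_dvd_iff.1 ?_ k hk
  rw [mul_add, pow_add, pow_mul, pow_mul]
  exact mul_dvd_mul (dvd_mul_of_dvd_right (pow_dvd_pow_of_dvd
    (dvd_mul_of_dvd_left (X_pow_dvd_windSeries hn) _) _) _) (pow_dvd_pow_of_dvd
    (dvd_mul_of_dvd_left (X_pow_dvd_windSeries hn) _) _)

/-- Decomposition of a walk `o → o` according to its winding excursions. -/
lemma coeff_eq_sum_windGreen {U : PowerSeries ℝ}
    (hU : U = 1 + (windSeries n H₁ + shortSeries n H₁ + (windSeries n H₂ + shortSeries n H₂)) * U)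
    {k M : ℕ} (hk : k < M) :
    PowerSeries.coeff k U = ∑ m ∈ range M, ∑ p ∈ antidiagonal m,
      (m.choose p.1 : ℝ) * PowerSeries.coeff k (windGreen n H₁ H₂ p.1 p.2) := by
  have hR := one_sub_inv_eq (X_dvd_shortSeries_add (n := n) (H₁ := H₁) (H₂ := H₂))
  change shortGreen n H₁ H₂ = 1 + _ * shortGreen n H₁ H₂ at hR
  set R := shortGreen n H₁ H₂ with hRdef
  have hU' : U = R + (windSeries n H₁ * R + windSeries n H₂ * R) * U := by
    linear_combination R * hU - U * hR
  rw [coeff_renewal hU' (dvd_add (dvd_mul_of_dvd_left (Dvd.intro _ rfl) _)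
    (dvd_mul_of_dvd_left (Dvd.intro _ rfl) _)) hk]
  refine sum_congr rfl fun m _ => ?_
  rw [(Commute.all _ _).add_pow', mul_sum, map_sum]
  refine sum_congr rfl fun p _ => ?_
  rw [windGreen, ← hRdef, mul_smul_comm, map_nsmul, nsmul_eq_mul, mul_assoc]

end

/-- The chain `2 P - 1`, which never holds at `o` or at the fast vertices. -/
noncomputable def fastP (n : ℕ) : Matrix (TwoCycleState n) (TwoCycleState n) ℝ :=
  (2 : ℝ) • tcP n - 1

/-- Holding probabilities of `fastP` along the cycle `i`, as a function of the position. -/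
noncomputable def cycleHold (n : ℕ) (i : Fin 2) (x : ℕ) : ℝ :=
  if i = 0 ∧ n / 4 ≤ x ∧ x ≤ 3 * n / 4 then 2 * goldenAlpha - 1 else 0

/-- The vertex at position `x` of the cycle `i`. -/
def cyclePos (n : ℕ) (i : Fin 2) (x : ℕ) : TwoCycleState n :=
  if h : 0 < x ∧ x < n then Sum.inr (i, ⟨x - 1, by omega⟩) else Sum.inl ()

section
variable {n : ℕ}

lemma cyclePos_of_not {i : Fin 2} {x : ℕ} (h : ¬(0 < x ∧ x < n)) :
    cyclePos n i x = Sum.inl () := dif_neg h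

lemma eq_cyclePos_inl {i : Fin 2} {x : ℕ} {u : Unit} :
    (Sum.inl u : TwoCycleState n) = cyclePos n i x ↔ ¬(0 < x ∧ x < n) := by
  unfold cyclePos
  split_ifs with h <;> simp [h]

lemma eq_cyclePos_inr {i i' : Fin 2} {x : ℕ} {j : Fin (n - 1)} :
    (Sum.inr (i', j) : TwoCycleState n) = cyclePos n i x ↔ i = i' ∧ (j : ℕ) + 1 = x := by
  unfold cyclePos
  split_ifs with h
  · simp only [Sum.inr.injEq, Prod.mk.injEq, Fin.ext_iff]
    omega
  · simp only [false_iff]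
    rintro ⟨-, h'⟩
    have := j.2
    omega

lemma tcStep_cyclePos {i : Fin 2} {x : ℕ} (hx : 0 < x) (hxn : x < n) (y : TwoCycleState n) :
    tcStep n (cyclePos n i x) y = (if y = cyclePos n i (x + 1) then 2 / 3 else 0)
      + (if y = cyclePos n i (x - 1) then 1 / 3 else 0) := by
  rw [cyclePos, dif_pos ⟨hx, hxn⟩]
  rcases y with u | ⟨i', j⟩
  · simp only [tcStep, eq_cyclePos_inl]
    congr 1 <;> apply if_congr _ rfl rfl <;> simp <;> omega
  · simp only [tcStep, eq_cyclePos_inr]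
    by_cases hi : i = i'
    · simp only [hi, if_true, true_and]
      congr 1
      apply if_congr _ rfl rfl
      omega
    · simp [hi]

lemma tcStep_origin (hn : 2 ≤ n) (y : TwoCycleState n) :
    tcStep n (Sum.inl ()) y = ∑ i : Fin 2, ((if y = cyclePos n i 1 then 1 / 3 else 0)
      + (if y = cyclePos n i (n - 1) then 1 / 6 else 0)) := by
  rcases y with u | ⟨i', j⟩
  · simp only [tcStep, eq_cyclePos_inl]
    rw [if_neg (by omega), if_neg (by omega)]
    simp
  · simp only [tcStep, eq_cyclePos_inr, Fin.sum_univ_two]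
    have e1 : (j : ℕ) + 1 = 1 ↔ (j : ℕ) = 0 := by omega
    have e2 : (j : ℕ) + 1 = n - 1 ↔ (j : ℕ) + 2 = n := by omega
    simp only [e1, e2]
    fin_cases i' <;> simp

lemma tcHold_cyclePos {i : Fin 2} {x : ℕ} (hx : 0 < x) (hxn : x < n) :
    2 * tcHold n (cyclePos n i x) - 1 = cycleHold n i x := by
  rw [cyclePos, dif_pos ⟨hx, hxn⟩]
  simp only [tcHold, cycleHold, Nat.sub_add_cancel (show 1 ≤ x by omega)]
  split_ifs <;> norm_num

lemma fastP_apply (x y : TwoCycleState n) :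
    fastP n x y = (if y = x then 2 * tcHold n x - 1 else 0)
      + (1 - (2 * tcHold n x - 1)) * tcStep n x y := by
  simp only [fastP, tcP, Matrix.sub_apply, Matrix.smul_apply, Matrix.one_apply, smul_eq_mul,
    eq_comm (a := y)]
  split_ifs <;> ring

lemma fastP_sum_cyclePos (f : TwoCycleState n → ℝ) {i : Fin 2} {x : ℕ} (hx : 0 < x) (hxn : x < n) :
    ∑ y, fastP n (cyclePos n i x) y * f y =
      stepAvg (cycleHold n i) (fun y => f (cyclePos n i y)) x := by
  simp only [fastP_apply, tcStep_cyclePos hx hxn, tcHold_cyclePos hx hxn, add_mul, ite_mul,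
    zero_mul, sum_add_distrib, mul_add, mul_ite, mul_zero, sum_ite_eq', mem_univ, if_true, stepAvg]
  ring

lemma fastP_sum_origin (hn : 2 ≤ n) (f : TwoCycleState n → ℝ) :
    ∑ y, fastP n (Sum.inl ()) y * f y =
      ∑ i : Fin 2, (1 / 3 * f (cyclePos n i 1) + 1 / 6 * f (cyclePos n i (n - 1))) := by
  have h : 2 * tcHold n (Sum.inl ()) - 1 = 0 := by simp [tcHold]
  simp only [fastP_apply, h, tcStep_origin hn, ite_self, zero_add, sub_zero, one_mul, sum_mul,
    add_mul, ite_mul, zero_mul]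
  rw [sum_comm]
  simp [sum_add_distrib]

/-- Probability that the chain `fastP` goes from `x` to `o` in `k` steps. -/
noncomputable def fastReturn (n k : ℕ) (x : TwoCycleState n) : ℝ := (fastP n ^ k) x (Sum.inl ())

lemma fastReturn_succ (k : ℕ) (x : TwoCycleState n) :
    fastReturn n (k + 1) x = ∑ y, fastP n x y * fastReturn n k y := by
  rw [fastReturn, pow_succ', Matrix.mul_apply]; rfl

lemma fastReturn_cyclePos (k : ℕ) (i : Fin 2) (x : ℕ) :
    fastReturn n k (cyclePos n i x) = ∑ q ∈ antidiagonal k,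
      exitProb n (cycleHold n i) (fun _ => 1) q.1 x * fastReturn n q.2 (Sum.inl ()) := by
  induction k generalizing x with
  | zero =>
    by_cases hx : 0 < x ∧ x < n
    · have : cyclePos n i x ≠ Sum.inl () := fun h => eq_cyclePos_inl.1 h.symm hx
      simp [exitProb, hx, fastReturn, this]
    · simp [exitProb, hx, cyclePos_of_not hx]
  | succ k ih =>
    rw [Nat.antidiagonal_succ, sum_cons, sum_map]
    by_cases hx : 0 < x ∧ x < n
    · rw [fastReturn_succ, fastP_sum_cyclePos _ hx.1 hx.2]
      simp only [exitProb, hx, and_self, if_true, stepAvg, ih, mul_sum, ← sum_add_distrib,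
        zero_mul, zero_add, Function.Embedding.prodMap, Function.Embedding.coeFn_mk, Prod.map,
        Function.Embedding.refl_apply, Nat.succ_eq_add_one]
      refine sum_congr rfl fun q _ => ?_
      ring
    · simp [exitProb, hx, cyclePos_of_not hx]

/-- Generating function of the return probabilities of `fastP` to `o`. -/
noncomputable def returnSeries (n : ℕ) : PowerSeries ℝ :=
  PowerSeries.mk fun k => fastReturn n k (Sum.inl ())

lemma returnSeries_eq (hn : 2 ≤ n) :
    returnSeries n = 1 + (windSeries n (cycleHold n 0) + shortSeries n (cycleHold n 0) +
      (windSeries n (cycleHold n 1) + shortSeries n (cycleHold n 1))) * returnSeries n := by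
  have hsum : ∀ i, windSeries n (cycleHold n i) + shortSeries n (cycleHold n i) =
      PowerSeries.X * PowerSeries.mk fun k =>
        1 / 3 * exitProb n (cycleHold n i) (fun _ => 1) k 1
        + 1 / 6 * exitProb n (cycleHold n i) (fun _ => 1) k (n - 1) := by
    intro i
    rw [windSeries, shortSeries, ← mul_add]
    congr 1
    ext k
    have := exitProb_add (n := n) (H := cycleHold n i) (β := fun x => if x = n then 1 else 0)
      (fun x => if x = n then 0 else 1) k 1
    have e : (fun y : ℕ => ((if y = n then 1 else 0) + if y = n then 0 else 1 : ℝ)) = fun _ => 1 := by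
      funext y; split_ifs <;> norm_num
    rw [e] at this
    simp only [map_add, PowerSeries.coeff_mk, this]
    ring
  rw [hsum, hsum, ← mul_add, mul_assoc]
  ext k
  cases k with
  | zero => simp [returnSeries, fastReturn]
  | succ k =>
    rw [map_add, PowerSeries.coeff_succ_X_mul, PowerSeries.coeff_one, if_neg (by omega), zero_add,
      PowerSeries.coeff_mul, returnSeries, PowerSeries.coeff_mk, fastReturn_succ,
      fastP_sum_origin hn, Fin.sum_univ_two]
    simp only [fastReturn_cyclePos, map_add, PowerSeries.coeff_mk, mul_sum, ← sum_add_distrib]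
    refine sum_congr rfl fun q _ => ?_
    ring

lemma tcP_pow_eq_sum (t : ℕ) : (tcP n ^ t) (Sum.inl ()) (Sum.inl ()) =
    ∑ k ∈ range (t + 1), fairBinom t k * fastReturn n k (Sum.inl ()) := by
  have h : tcP n = (1 / 2 : ℝ) • (fastP n + 1) := by
    rw [fastP, sub_add_cancel, smul_smul]; norm_num
  rw [h, smul_pow, (Commute.one_right _).add_pow, Matrix.smul_apply, Matrix.sum_apply, smul_sum]
  refine sum_congr rfl fun k _ => ?_
  rw [one_pow, mul_one, ← Nat.cast_comm, ← nsmul_eq_mul, Matrix.smul_apply, fairBinom, fastReturn]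
  simp only [nsmul_eq_mul, smul_eq_mul, one_div, inv_pow]
  ring

/-- The return probability, decomposed by the number of windings around each cycle. -/
lemma tcP_pow_eq_sum_windGreen (hn : 2 ≤ n) {t M : ℕ} (hM : t < M) :
    (tcP n ^ t) (Sum.inl ()) (Sum.inl ()) = ∑ m ∈ range M, ∑ p ∈ antidiagonal m,
      (m.choose p.1 : ℝ) * ∑ k ∈ range (t + 1), fairBinom t k *
        PowerSeries.coeff k (windGreen n (cycleHold n 0) (cycleHold n 1) p.1 p.2) := by
  have hk : ∀ k ∈ range (t + 1), fairBinom t k * fastReturn n k (Sum.inl ()) =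
      ∑ m ∈ range M, ∑ p ∈ antidiagonal m, (m.choose p.1 : ℝ) * (fairBinom t k *
        PowerSeries.coeff k (windGreen n (cycleHold n 0) (cycleHold n 1) p.1 p.2)) := by
    intro k hk
    have := coeff_eq_sum_windGreen (returnSeries_eq hn) (k := k) (M := M)
      (by have := mem_range.1 hk; omega)
    rw [returnSeries, PowerSeries.coeff_mk] at this
    rw [this, mul_sum]
    refine sum_congr rfl fun m _ => ?_
    rw [mul_sum]
    refine sum_congr rfl fun p _ => ?_
    ring
  rw [tcP_pow_eq_sum, sum_congr rfl hk, sum_comm]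
  refine sum_congr rfl fun m _ => ?_
  rw [sum_comm]
  refine sum_congr rfl fun p _ => ?_
  rw [mul_sum]

lemma goldenAlpha_eq : goldenAlpha = Real.goldenRatio - 1 := by
  have h5 : Real.sqrt 5 ^ 2 = 5 := Real.sq_sqrt (by norm_num)
  have : 0 ≤ Real.sqrt 5 := Real.sqrt_nonneg 5
  rw [goldenAlpha, Real.goldenRatio, div_eq_iff (by positivity)]
  linear_combination (-1 / 2 : ℝ) * h5

lemma cycleHold_admissible (i : Fin 2) : Admissible (cycleHold n i) := by
  intro x
  have := goldenRatio_bounds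
  unfold cycleHold
  rw [goldenAlpha_eq]
  split_ifs <;> constructor <;> linarith

lemma cycleHold_zero_mean (hn : 0 < n) (h4 : 4 ∣ n) :
    |3 * ∑ x ∈ range (n - 1), 1 / (1 - cycleHold n 0 (x + 1))
      - 3 / 4 * (3 + Real.goldenRatio) * n| ≤ 3 := by
  obtain ⟨q, rfl⟩ := h4
  have hq : 0 < q := by omega
  have hφ := goldenRatio_bounds
  have hf : ∀ x, 1 / (1 - cycleHold (4 * q) 0 (x + 1)) =
      1 + if x ∈ Icc (q - 1) (3 * q - 1) then (Real.goldenRatio - 1) / 2 else 0 := by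
    intro x
    have e : ((0 : Fin 2) = 0 ∧ 4 * q / 4 ≤ x + 1 ∧ x + 1 ≤ 3 * (4 * q) / 4) ↔
        x ∈ Icc (q - 1) (3 * q - 1) := by
      rw [mem_Icc]; simp only [true_and]; omega
    rw [cycleHold, goldenAlpha_eq, if_congr e rfl rfl]
    split_ifs
    · have := Real.goldenRatio_sq
      rw [div_eq_iff (by linarith)]
      linear_combination this
    · norm_num
  have hsub : range (4 * q - 1) ∩ Icc (q - 1) (3 * q - 1) = Icc (q - 1) (3 * q - 1) := by
    rw [inter_eq_right]
    intro x hx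
    rw [mem_Icc] at hx
    rw [mem_range]; omega
  rw [sum_congr rfl fun x _ => hf x, sum_add_distrib, sum_ite_mem, hsub, sum_const, sum_const,
    card_range, Nat.card_Icc, show 3 * q - 1 + 1 - (q - 1) = 2 * q + 1 by omega, nsmul_eq_mul,
    nsmul_eq_mul, Nat.cast_sub (by omega)]
  push_cast
  rw [abs_le]
  constructor <;> nlinarith

lemma cycleHold_one_mean (hn : 0 < n) :
    |3 * ∑ x ∈ range (n - 1), 1 / (1 - cycleHold n 1 (x + 1)) - 3 * n| ≤ 3 := by
  simp [cycleHold, Nat.cast_sub (show 1 ≤ n by omega), mul_sub]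

end

/-- Probability that the chain `fastP` returns to `o` at time `k`, having wound `k₁` times around
the first cycle and `k₂` times around the second, in a fixed order. -/
noncomputable def windWeight (n k₁ k₂ k : ℕ) : ℝ :=
  PowerSeries.coeff k (windGreen n (cycleHold n 0) (cycleHold n 1) k₁ k₂)

/-- Mean duration, in units of `n`, of `x` windings around the first and `y` windings around the
second cycle. -/
noncomputable def windTime (x y : ℝ) : ℝ := 3 / 4 * (3 + Real.goldenRatio) * x + 3 * y

section
variable {n : ℕ}

lemma windWeight_hasSum (hn : 2 ≤ n) (k₁ k₂ : ℕ) :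
    ∃ B, (1 / 2 : ℝ) ^ (k₁ + k₂) ≤ B ∧ HasSum (windWeight n k₁ k₂) B := by
  have h := (windGreen_eval_one hn (cycleHold_admissible (n := n) 0)
    (cycleHold_admissible (n := n) 1) k₁ k₂).2
  simp only [one_pow, mul_one] at h
  refine ⟨_, ?_, h⟩
  have hw := windProb_bounds hn
  rw [pow_add, mul_assoc]
  apply le_mul_of_one_le_left (by positivity)
  rw [le_div_iff₀ (by linarith)]
  linarith

lemma windWeight_nonneg (hn : 2 ≤ n) (k₁ k₂ k : ℕ) : 0 ≤ windWeight n k₁ k₂ k :=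
  (windGreen_eval_one hn (cycleHold_admissible 0) (cycleHold_admissible 1) k₁ k₂).1 k

lemma windWeight_sum_exp_le (hn : 2 ≤ n) (h4 : 4 ∣ n) {s : ℝ} (hs : |s| ≤ 1 / 156) (k₁ k₂ K : ℕ) :
    ∑ k ∈ range K, windWeight n k₁ k₂ k * Real.exp (s * k) ≤
      9 * (1 / 2) ^ (k₁ + k₂) * Real.exp (s * (n * windTime k₁ k₂)
        + (k₁ + k₂) * (168 * |s| + 100 * s ^ 2 * n)) := by
  have := windGreen_sum_exp_le hn (cycleHold_admissible 0) (cycleHold_admissible 1) hs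
    (cycleHold_zero_mean (by omega) h4) (cycleHold_one_mean (by omega)) k₁ k₂ K
  norm_num only at this ⊢
  exact this

/-- At most `t / n` windings: the error terms in the exponential moments are bounded. -/
lemma wind_error_le {m t : ℕ} (hn : 0 < n) (htn : t ≤ n ^ 2) (hm : n * m ≤ t) {a σ : ℝ}
    (ha : 0 ≤ a) (hσ : σ = a / Real.sqrt t) : (m : ℝ) * (168 * σ + 100 * σ ^ 2 * n) ≤
      168 * a + 100 * a ^ 2 := by
  rcases Nat.eq_zero_or_pos t with rfl | ht
  · simp only [nonpos_iff_eq_zero, mul_eq_zero, hn.ne', false_or] at hm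
    subst hm
    simp only [CharP.cast_eq_zero, zero_mul]; positivity
  have ht0 : (0 : ℝ) < t := by exact_mod_cast ht
  have hr : 0 < Real.sqrt t := Real.sqrt_pos.2 ht0
  have hsq : Real.sqrt t ^ 2 = t := Real.sq_sqrt ht0.le
  have hrn : Real.sqrt t ≤ n := by
    rw [Real.sqrt_le_left (by positivity)]; exact_mod_cast htn
  have hmr : (n : ℝ) * m ≤ t := by exact_mod_cast hm
  have h1 : (m : ℝ) ≤ Real.sqrt t := by
    have : (m : ℝ) * Real.sqrt t ≤ Real.sqrt t * Real.sqrt t := by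
      nlinarith [mul_le_mul_of_nonneg_left hrn (Nat.cast_nonneg (α := ℝ) m)]
    exact le_of_mul_le_mul_right this hr
  have e1 : (m : ℝ) * σ ≤ a := by
    rw [hσ, ← mul_div_assoc, div_le_iff₀ hr, mul_comm]; gcongr
  have e2 : (m : ℝ) * n * σ ^ 2 ≤ a ^ 2 := by
    rw [hσ, div_pow, hsq, ← mul_div_assoc, div_le_iff₀ ht0, mul_comm]
    gcongr; linarith
  linarith

lemma windWeight_sum_fairBinom_le (hn : 2 ≤ n) (h4 : 4 ∣ n) {t : ℕ} (ht : 312 ^ 2 ≤ t)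
    (htn : t + 1 ≤ n ^ 2) (k₁ k₂ : ℕ) :
    ∑ k ∈ range (t + 1), fairBinom t k * windWeight n k₁ k₂ k ≤
      144 * Real.exp 736 * (1 / Real.sqrt (t + 1)) * (1 / 2) ^ (k₁ + k₂) *
        Real.exp (-(2 * n / Real.sqrt (t + 1) * |windTime k₁ k₂ - t / (2 * n)|)) := by
  have hn0 : (0 : ℝ) < n := by exact_mod_cast (show 0 < n by omega)
  by_cases hm : t < n * (k₁ + k₂)
  · rw [sum_eq_zero fun k hk => by
      rw [windWeight, coeff_windGreen_eq_zero (by omega)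
        (by have := mem_range.1 hk; omega), mul_zero]]
    positivity
  have hr : 312 ≤ Real.sqrt (t + 1) := by
    apply Real.le_sqrt_of_sq_le
    have : ((312 ^ 2 : ℕ) : ℝ) ≤ t := Nat.cast_le.2 ht
    push_cast at this; linarith
  set r := Real.sqrt (t + 1) with hrdef
  have hr0 : 0 < r := by linarith
  have key : ∀ s : ℝ, |s| = 2 / r → ∑ k ∈ range (t + 1), fairBinom t k * windWeight n k₁ k₂ k ≤
      144 * Real.exp 736 * (1 / r) * (1 / 2) ^ (k₁ + k₂) *
        Real.exp (s * (n * windTime k₁ k₂ - t / 2)) := by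
    intro s hs
    have hb : ∀ k : ℕ, fairBinom t k ≤ 16 / r * Real.exp (-(s * t / 2)) * Real.exp (s * k) := by
      intro k
      refine (fairBinom_upper t k).trans ?_
      rw [mul_assoc, ← Real.exp_add]
      gcongr
      have : |s * (2 * k - t)| = 2 / r * |2 * (k : ℝ) - t| := by rw [abs_mul, hs]
      have := neg_abs_le (s * (2 * k - t))
      have e : |2 * (k : ℝ) - t| / r = 2 / r * |2 * (k : ℝ) - t| / 2 := by ring
      rw [e]; linarith
    have herr : ((k₁ : ℝ) + k₂) * (168 * |s| + 100 * s ^ 2 * n) ≤ 736 := by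
      have := wind_error_le (m := k₁ + k₂) (t := t + 1) (n := n) (by omega) htn (by omega)
        (a := 2) (by norm_num) (σ := |s|) (by rw [hs, hrdef]; push_cast; rfl)
      rw [sq_abs] at this
      push_cast at this
      linarith
    calc ∑ k ∈ range (t + 1), fairBinom t k * windWeight n k₁ k₂ k
        ≤ ∑ k ∈ range (t + 1), 16 / r * Real.exp (-(s * t / 2)) * Real.exp (s * k)
            * windWeight n k₁ k₂ k := by
          refine sum_le_sum fun k _ => mul_le_mul_of_nonneg_right (hb k) (windWeight_nonneg hn _ _ _)
      _ = 16 / r * Real.exp (-(s * t / 2)) *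
            ∑ k ∈ range (t + 1), windWeight n k₁ k₂ k * Real.exp (s * k) := by
          rw [mul_sum]; refine sum_congr rfl fun k _ => ?_
          ring
      _ ≤ 16 / r * Real.exp (-(s * t / 2)) * (9 * (1 / 2) ^ (k₁ + k₂) *
            Real.exp (s * (n * windTime k₁ k₂) + (k₁ + k₂) * (168 * |s| + 100 * s ^ 2 * n))) := by
          gcongr
          refine windWeight_sum_exp_le hn h4 ?_ _ _ _
          rw [hs, div_le_div_iff₀ hr0 (by norm_num)]; linarith
      _ ≤ 16 / r * Real.exp (-(s * t / 2)) * (9 * (1 / 2) ^ (k₁ + k₂) *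
            Real.exp (s * (n * windTime k₁ k₂) + 736)) := by gcongr
      _ = _ := by
          rw [show s * (n * windTime k₁ k₂ - t / 2) = s * (n * windTime k₁ k₂) + -(s * t / 2) by ring,
            Real.exp_add, Real.exp_add]
          ring
  have e : (n : ℝ) * windTime k₁ k₂ - t / 2 = n * (windTime k₁ k₂ - t / (2 * n)) := by
    field_simp
  rcases le_total 0 (windTime k₁ k₂ - t / (2 * n)) with h | h
  · refine (key (-(2 / r)) (by rw [abs_neg, abs_of_pos (by positivity)])).trans_eq ?_
    rw [abs_of_nonneg h, e]; congr 2; ring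
  · refine (key (2 / r) (abs_of_pos (by positivity))).trans_eq ?_
    rw [abs_of_nonpos h, e]; congr 2; ring

end

lemma summable_pow_natAbs {r : ℝ} (h0 : 0 ≤ r) (h1 : r < 1) :
    Summable fun x : ℤ => r ^ x.natAbs := by
  apply Summable.of_nat_of_neg <;> simpa using summable_geometric_of_lt_one h0 h1

/-- The winding numbers `(k₁, k₂)` are spread out in the rescaled coordinates. -/
lemma exists_wind_lattice_sum_le : ∃ C : ℝ, 0 < C ∧ ∀ (Q τ : ℝ), 1 ≤ Q → ∀ s : Finset (ℕ × ℕ),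
    ∑ p ∈ s, Real.exp (-(Q / 4 * |windTime p.1 p.2 - τ|) - |(p.1 : ℝ) - p.2| / (4 * Q)) ≤ C := by
  set r := Real.exp (-(1 / 32)) with hr
  have hr0 : 0 < r := Real.exp_pos _
  have hr1 : r < 1 := by rw [hr, Real.exp_lt_one_iff]; norm_num
  have hs := summable_pow_natAbs hr0.le hr1
  have hs2 := hs.mul_of_nonneg hs (fun _ => by positivity) (fun _ => by positivity)
  refine ⟨Real.exp 1 * ((∑' x : ℤ × ℤ, r ^ x.1.natAbs * r ^ x.2.natAbs) + 1), ?_, ?_⟩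
  · have : 0 ≤ ∑' x : ℤ × ℤ, r ^ x.1.natAbs * r ^ x.2.natAbs :=
      tsum_nonneg fun _ => by positivity
    positivity
  intro Q τ hQ s
  have hQ0 : 0 < Q := by linarith
  let F : ℕ × ℕ → ℤ × ℤ := fun p =>
    (⌊8 * (Q * (windTime p.1 p.2 - τ))⌋, ⌊8 * (((p.1 : ℝ) - p.2) / Q)⌋)
  have hfl : ∀ x y : ℝ, ⌊8 * x⌋ = ⌊8 * y⌋ → |x - y| < 1 / 4 := by
    intro x y h
    have := Int.abs_sub_lt_one_of_floor_eq_floor h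
    rw [← mul_sub, abs_mul, abs_of_pos (by norm_num : (0 : ℝ) < 8)] at this
    linarith
  have hinj : Set.InjOn F s := by
    rintro ⟨a, b⟩ - ⟨c, d⟩ - h
    simp only [F, Prod.mk.injEq] at h
    have h1 := hfl _ _ h.1
    have h2 := hfl _ _ h.2
    have := loop_counts_separated Q hQ ((a : ℤ) - c) ((b : ℤ) - d)
      (by
        rw [← mul_sub, abs_mul, abs_of_pos hQ0] at h1
        push_cast
        rw [mul_comm]
        calc _ = Q * |windTime a b - τ - (windTime c d - τ)| := by
              congr 2; unfold windTime; ring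
          _ < _ := h1)
      (by
        rw [← sub_div, abs_div, abs_of_pos hQ0, div_lt_iff₀ hQ0] at h2
        push_cast
        calc _ = |(a : ℝ) - b - (c - d)| := by congr 1; ring
          _ < _ := by linarith)
    simp only [Prod.mk.injEq]
    omega
  have habs : ∀ x : ℝ, Real.exp (-(|x| / 4)) ≤ Real.exp (1 / 32) * r ^ (⌊8 * x⌋).natAbs := by
    intro x
    rw [hr, ← Real.exp_nat_mul, ← Real.exp_add]
    gcongr
    have h : ((⌊8 * x⌋.natAbs : ℕ) : ℝ) = |(⌊8 * x⌋ : ℝ)| := by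
      rw [Nat.cast_natAbs, Int.cast_abs]
    have h1 := Int.floor_le (8 * x)
    have h2 := Int.lt_floor_add_one (8 * x)
    have h3 : |(⌊8 * x⌋ : ℝ)| ≤ 8 * |x| + 1 := by
      rw [abs_le]
      constructor <;> linarith [le_abs_self x, neg_abs_le x]
    rw [h]; linarith
  calc _ ≤ ∑ p ∈ s, Real.exp 1 * (r ^ (F p).1.natAbs * r ^ (F p).2.natAbs) := by
        refine sum_le_sum fun p _ => ?_
        have h1 := habs (Q * (windTime p.1 p.2 - τ))
        have h2 := habs (((p.1 : ℝ) - p.2) / Q)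
        rw [abs_mul, abs_of_pos hQ0] at h1
        rw [abs_div, abs_of_pos hQ0] at h2
        calc _ = Real.exp (-(Q * |windTime p.1 p.2 - τ| / 4)) *
              Real.exp (-(|(p.1 : ℝ) - p.2| / Q / 4)) := by
              rw [← Real.exp_add]; congr 1; field_simp; ring
          _ ≤ (Real.exp (1 / 32) * r ^ (F p).1.natAbs) * (Real.exp (1 / 32) * r ^ (F p).2.natAbs) :=
              mul_le_mul h1 h2 (Real.exp_pos _).le (by positivity)
          _ = Real.exp (1 / 32 + 1 / 32) * (r ^ (F p).1.natAbs * r ^ (F p).2.natAbs) := by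
              rw [Real.exp_add]; ring
          _ ≤ _ := by gcongr; norm_num
    _ = Real.exp 1 * ∑ x ∈ s.image F, r ^ x.1.natAbs * r ^ x.2.natAbs := by
        rw [sum_image hinj, mul_sum]
    _ ≤ _ := by
        gcongr
        have := hs2.sum_le_tsum (s.image F) (fun _ _ => by positivity)
        linarith

lemma fairBinom_mul_exp_le {Q τ : ℝ} (hQ : 1 ≤ Q) (hτ : Q ^ 2 / 100 ≤ τ) {k₁ k₂ : ℕ}
    (hm : ((k₁ + k₂ : ℕ) : ℝ) ≤ 10 * Q ^ 2) :
    fairBinom (k₁ + k₂) k₁ * Real.exp (-(Q / 2 * |windTime k₁ k₂ - τ|)) ≤ 12800 / Q *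
      Real.exp (-(Q / 4 * |windTime k₁ k₂ - τ|) - |(k₁ : ℝ) - k₂| / (4 * Q)) := by
  have hQ0 : 0 < Q := by linarith
  have hm0 : (0 : ℝ) < ((k₁ + k₂ : ℕ) : ℝ) + 1 := by positivity
  set r := Real.sqrt (((k₁ + k₂ : ℕ) : ℝ) + 1) with hr
  have hr0 : 0 < r := Real.sqrt_pos.2 hm0
  have hr4 : r ≤ 4 * Q := by
    rw [hr, Real.sqrt_le_left (by positivity)]; nlinarith
  set d := |windTime k₁ k₂ - τ| with hd
  have hd0 : 0 ≤ d := abs_nonneg _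
  have h1 : fairBinom (k₁ + k₂) k₁ ≤ 16 / r * Real.exp (-(|(k₁ : ℝ) - k₂| / (4 * Q))) := by
    refine (fairBinom_upper _ _).trans ?_
    rw [← hr, show 2 * (k₁ : ℝ) - ((k₁ + k₂ : ℕ) : ℝ) = k₁ - k₂ by push_cast; ring]
    gcongr
  have h2 : 1 / r * Real.exp (-(Q / 4 * d)) ≤ 800 / Q := by
    by_cases hc : Q ^ 2 / 800 ≤ ((k₁ + k₂ : ℕ) : ℝ)
    · have hr30 : Q / 800 ≤ r := by
        apply Real.le_sqrt_of_sq_le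
        nlinarith
      calc _ ≤ 1 / (Q / 800) * 1 := by
            gcongr
            rw [Real.exp_le_one_iff]
            have : 0 ≤ Q / 4 * d := by positivity
            linarith
        _ = _ := by field_simp
    · have hφ := goldenRatio_bounds
      have hw : windTime k₁ k₂ ≤ 4 * ((k₁ + k₂ : ℕ) : ℝ) := by
        unfold windTime; push_cast
        nlinarith [Nat.cast_nonneg (α := ℝ) k₁, Nat.cast_nonneg (α := ℝ) k₂]
      have hd1 : Q ^ 2 / 200 ≤ d := by
        have := neg_abs_le (windTime k₁ k₂ - τ)
        rw [← hd] at this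
        linarith
      have hr1 : 1 ≤ r := by
        apply Real.le_sqrt_of_sq_le
        have : (0 : ℝ) ≤ ((k₁ + k₂ : ℕ) : ℝ) := by positivity
        linarith
      have hu : Q / 800 ≤ Q / 4 * d := by nlinarith
      have hexp := Real.add_one_le_exp (Q / 4 * d)
      calc _ ≤ 1 / 1 * (1 / Real.exp (Q / 4 * d)) := by
            rw [Real.exp_neg, one_div (Real.exp _)]; gcongr
        _ ≤ 1 / 1 * (1 / (Q / 800)) := by gcongr; linarith
        _ = _ := by field_simp
  calc _ ≤ 16 / r * Real.exp (-(|(k₁ : ℝ) - k₂| / (4 * Q))) * Real.exp (-(Q / 2 * d)) := by gcongr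
    _ = 16 * (1 / r * Real.exp (-(Q / 4 * d))) *
        Real.exp (-(Q / 4 * d) - |(k₁ : ℝ) - k₂| / (4 * Q)) := by
        rw [sub_eq_add_neg (-(Q / 4 * d)), Real.exp_add,
          show -(Q / 2 * d) = -(Q / 4 * d) + -(Q / 4 * d) by ring, Real.exp_add]
        ring
    _ ≤ 16 * (800 / Q) * Real.exp (-(Q / 4 * d) - |(k₁ : ℝ) - k₂| / (4 * Q)) := by gcongr
    _ = _ := by ring

lemma exists_return_prob_upper : ∃ C : ℝ, 0 < C ∧ ∀ (n t : ℕ) (Q : ℝ), (n : ℝ) = Q ^ 4 → 4 ∣ n →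
    20 ≤ Q → Q ^ 6 / 50 ≤ t → t ≤ 10 * Q ^ 6 →
      (tcP n ^ t) (Sum.inl ()) (Sum.inl ()) ≤ C / n := by
  obtain ⟨C, hC, hlat⟩ := exists_wind_lattice_sum_le
  refine ⟨144 * Real.exp 736 * 8 * 12800 * C, by positivity, ?_⟩
  intro n t Q hnQ h4 hQ ht1 ht2
  have hQ0 : 0 < Q := by linarith
  have hn0 : (0 : ℝ) < n := by rw [hnQ]; positivity
  have hn2 : 2 ≤ n := by
    have := Nat.le_of_dvd (by exact_mod_cast hn0) h4
    omega
  have hQ2 : 400 ≤ Q ^ 2 := by nlinarith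
  have hQ6 : (20 : ℝ) ^ 6 ≤ Q ^ 6 := by gcongr
  have ht312 : 312 ^ 2 ≤ t := by
    have : (312 ^ 2 : ℝ) ≤ t := by linarith
    exact_mod_cast this
  have htn : t + 1 ≤ n ^ 2 := by
    have : ((t : ℝ) + 1) ≤ (n : ℝ) ^ 2 := by
      rw [hnQ]
      have : 400 * Q ^ 6 ≤ Q ^ 2 * Q ^ 6 := by gcongr
      nlinarith
    exact_mod_cast this
  set r := Real.sqrt (t + 1) with hr
  have hr4 : r ≤ 4 * Q ^ 3 := by
    rw [hr, Real.sqrt_le_left (by positivity)]; nlinarith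
  have hr8 : Q ^ 3 / 8 ≤ r := by
    apply Real.le_sqrt_of_sq_le; nlinarith
  have hr0 : 0 < r := lt_of_lt_of_le (by positivity) hr8
  set τ : ℝ := t / (2 * n) with hτ
  have hτQ : Q ^ 2 / 100 ≤ τ := by
    rw [hτ, hnQ, le_div_iff₀ (by positivity)]; nlinarith
  set e : ℕ × ℕ → ℝ := fun p =>
    Real.exp (-(Q / 4 * |windTime p.1 p.2 - τ|) - |(p.1 : ℝ) - p.2| / (4 * Q)) with he
  have hterm : ∀ p : ℕ × ℕ, ((p.1 + p.2).choose p.1 : ℝ) *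
      ∑ k ∈ range (t + 1), fairBinom t k * windWeight n p.1 p.2 k ≤
        144 * Real.exp 736 * (1 / r) * (12800 / Q) * e p := by
    intro p
    by_cases hm : t < n * (p.1 + p.2)
    · rw [sum_eq_zero fun k hk => by
        rw [windWeight, coeff_windGreen_eq_zero (by omega)
          (by have := mem_range.1 hk; omega), mul_zero]]
      rw [mul_zero]; positivity
    have hmt : ((p.1 + p.2 : ℕ) : ℝ) ≤ 10 * Q ^ 2 := by
      have : (n : ℝ) * ((p.1 + p.2 : ℕ) : ℝ) ≤ t := by exact_mod_cast not_lt.1 hm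
      have h : Q ^ 4 * ((p.1 + p.2 : ℕ) : ℝ) ≤ Q ^ 4 * (10 * Q ^ 2) := by
        calc _ ≤ (t : ℝ) := by rw [← hnQ]; exact this
          _ ≤ 10 * Q ^ 6 := ht2
          _ = _ := by ring
      exact le_of_mul_le_mul_left h (by positivity)
    calc _ ≤ ((p.1 + p.2).choose p.1 : ℝ) * (144 * Real.exp 736 * (1 / r) * (1 / 2) ^ (p.1 + p.2) *
          Real.exp (-(2 * n / r * |windTime p.1 p.2 - τ|))) := by
          gcongr
          exact windWeight_sum_fairBinom_le hn2 h4 ht312 htn p.1 p.2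
      _ = 144 * Real.exp 736 * (1 / r) * (fairBinom (p.1 + p.2) p.1 *
          Real.exp (-(2 * n / r * |windTime p.1 p.2 - τ|))) := by
          rw [fairBinom, one_div_pow]; ring
      _ ≤ 144 * Real.exp 736 * (1 / r) * (fairBinom (p.1 + p.2) p.1 *
          Real.exp (-(Q / 2 * |windTime p.1 p.2 - τ|))) := by
          have h0 := fairBinom_nonneg (p.1 + p.2) p.1
          have hq : Q / 2 ≤ 2 * n / r := by
            rw [hnQ, div_le_div_iff₀ (by norm_num) hr0]
            nlinarith
          gcongr _ * (_ * Real.exp (-(?_ * _)))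
      _ ≤ 144 * Real.exp 736 * (1 / r) * (12800 / Q * e p) := by
          gcongr 144 * Real.exp 736 * (1 / r) * ?_
          exact fairBinom_mul_exp_le (by linarith) hτQ hmt
      _ = _ := by ring
  have hdisj : Set.PairwiseDisjoint (range (t + 1) : Set ℕ) (antidiagonal : ℕ → Finset (ℕ × ℕ)) := by
    intro a _ b _ hab
    rw [Function.onFun, disjoint_left]
    intro p hp hp'
    rw [HasAntidiagonal.mem_antidiagonal] at hp hp'
    omega
  calc _ = ∑ m ∈ range (t + 1), ∑ p ∈ antidiagonal m, (m.choose p.1 : ℝ) *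
        ∑ k ∈ range (t + 1), fairBinom t k * windWeight n p.1 p.2 k :=
        tcP_pow_eq_sum_windGreen hn2 (Nat.lt_succ_self t)
    _ ≤ ∑ m ∈ range (t + 1), ∑ p ∈ antidiagonal m,
          144 * Real.exp 736 * (1 / r) * (12800 / Q) * e p := by
        refine sum_le_sum fun m _ => sum_le_sum fun p hp => ?_
        rw [← HasAntidiagonal.mem_antidiagonal.1 hp]
        exact hterm p
    _ = 144 * Real.exp 736 * (1 / r) * (12800 / Q) *
          ∑ p ∈ (range (t + 1)).biUnion antidiagonal, e p := by
        rw [sum_biUnion hdisj, mul_sum]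
        refine sum_congr rfl fun m _ => ?_
        rw [mul_sum]
    _ ≤ 144 * Real.exp 736 * (1 / (Q ^ 3 / 8)) * (12800 / Q) * C := by
        gcongr
        exact hlat Q τ (by linarith) _
    _ = _ := by rw [hnQ]; field_simp

/-- The bulk of the winding weight sits at times within `O(√t)` of `t / 2`. -/
lemma windWeight_near_sum_ge {n t k₁ k₂ : ℕ} (hn : 2 ≤ n) (h4 : 4 ∣ n) (htn : t ≤ n ^ 2)
    (hm : n * (k₁ + k₂) ≤ t) (ht : 736 ^ 2 ≤ t)
    (hd : n * |windTime k₁ k₂ - t / (2 * n)| ≤ 96 * Real.sqrt t) :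
    1 / 2 * (1 / 2) ^ (k₁ + k₂) ≤ ∑ k ∈ range (t + 1) with
      |2 * ((k : ℕ) : ℝ) - t| ≤ 736 * Real.sqrt t, windWeight n k₁ k₂ k := by
  have hn0 : (0 : ℝ) < n := by exact_mod_cast (show 0 < n by omega)
  obtain ⟨B, hB, hsum⟩ := windWeight_hasSum hn k₁ k₂
  have hr : 736 ≤ Real.sqrt t := by
    apply Real.le_sqrt_of_sq_le
    exact_mod_cast ht
  have hsq : Real.sqrt t * Real.sqrt t = t := Real.mul_self_sqrt (by positivity)
  set r := Real.sqrt t with hrdef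
  have hr0 : 0 < r := by linarith
  have hmom : ∀ (s : ℝ) (T : ℕ), |s| = 1 / r →
      ∑ k ∈ range T, windWeight n k₁ k₂ k * Real.exp (s * (k - t / 2)) ≤
        9 * (1 / 2) ^ (k₁ + k₂) * Real.exp 364 := by
    intro s T hs
    have herr : ((k₁ : ℝ) + k₂) * (168 * |s| + 100 * s ^ 2 * n) ≤ 268 := by
      have := wind_error_le (m := k₁ + k₂) (t := t) (n := n) (by omega) htn hm
        (a := 1) (by norm_num) (σ := |s|) hs
      rw [sq_abs] at this
      push_cast at this
      linarith
    have hdev : s * (n * windTime k₁ k₂) - s * t / 2 ≤ 96 := by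
      have e : s * (n * windTime k₁ k₂) - s * t / 2 = s * (n * (windTime k₁ k₂ - t / (2 * n))) := by
        field_simp
      rw [e]
      calc _ ≤ |s| * (n * |windTime k₁ k₂ - t / (2 * n)|) := by
            refine (le_abs_self _).trans_eq ?_
            rw [abs_mul, abs_mul, abs_of_pos hn0]
        _ ≤ 1 / r * (96 * r) := by rw [hs]; gcongr
        _ = 96 := by field_simp
    calc _ = (∑ k ∈ range T, windWeight n k₁ k₂ k * Real.exp (s * k)) * Real.exp (-(s * t / 2)) := by
          rw [sum_mul]
          refine sum_congr rfl fun k _ => ?_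
          rw [mul_assoc, ← Real.exp_add]; congr 2; ring
      _ ≤ 9 * (1 / 2) ^ (k₁ + k₂) * Real.exp (s * (n * windTime k₁ k₂)
        + (k₁ + k₂) * (168 * |s| + 100 * s ^ 2 * n)) * Real.exp (-(s * t / 2)) := by
          gcongr
          refine windWeight_sum_exp_le hn h4 ?_ _ _ _
          rw [hs, div_le_div_iff₀ hr0 (by norm_num)]; linarith
      _ ≤ _ := by
          rw [mul_assoc, ← Real.exp_add]
          gcongr
          linarith
  have hfar : ∀ T : ℕ, ∑ k ∈ range T with ¬|2 * ((k : ℕ) : ℝ) - t| ≤ 736 * r,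
      windWeight n k₁ k₂ k ≤ 1 / 2 * (1 / 2) ^ (k₁ + k₂) := by
    intro T
    have h18 : 18 * Real.exp (-4) ≤ 1 / 2 := by
      have h1 : (2.7 : ℝ) ^ 4 ≤ Real.exp 1 ^ 4 := by
        gcongr
        exact (by norm_num : (2.7 : ℝ) ≤ 2.7182818283).trans Real.exp_one_gt_d9.le
      rw [← Real.exp_nat_mul] at h1
      norm_num at h1
      rw [Real.exp_neg, ← div_eq_mul_inv, div_le_iff₀ (Real.exp_pos _)]
      linarith
    have hpt : ∀ k ∈ (range T).filter (fun k : ℕ => ¬|2 * ((k : ℕ) : ℝ) - t| ≤ 736 * r),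
        windWeight n k₁ k₂ k ≤ Real.exp (-368) *
          (windWeight n k₁ k₂ k * Real.exp (1 / r * (k - t / 2))
            + windWeight n k₁ k₂ k * Real.exp (-(1 / r) * (k - t / 2))) := by
      intro k hk
      have hk' := not_le.1 (mem_filter.1 hk).2
      have hw := windWeight_nonneg hn k₁ k₂ k
      have hone : 1 ≤ Real.exp (-368) * (Real.exp (1 / r * (k - t / 2))
          + Real.exp (-(1 / r) * (k - t / 2))) := by
        rw [mul_add, ← Real.exp_add, ← Real.exp_add]
        rcases lt_abs.1 hk' with h | h
        · have : 368 ≤ 1 / r * ((k : ℝ) - t / 2) := by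
            rw [one_div_mul_eq_div, le_div_iff₀ hr0]; linarith
          have h1 := Real.one_le_exp (show 0 ≤ -368 + 1 / r * ((k : ℝ) - t / 2) by linarith)
          have h2 := Real.exp_pos (-368 + -(1 / r) * ((k : ℝ) - t / 2))
          linarith
        · have : 368 ≤ 1 / r * -((k : ℝ) - t / 2) := by
            rw [one_div_mul_eq_div, le_div_iff₀ hr0]; linarith
          have h1 := Real.one_le_exp (show 0 ≤ -368 + -(1 / r) * ((k : ℝ) - t / 2) by linarith)
          have h2 := Real.exp_pos (-368 + 1 / r * ((k : ℝ) - t / 2))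
          linarith
      calc _ ≤ windWeight n k₁ k₂ k * (Real.exp (-368) * (Real.exp (1 / r * (k - t / 2))
          + Real.exp (-(1 / r) * (k - t / 2)))) := le_mul_of_one_le_right hw hone
        _ = _ := by ring
    calc _ ≤ ∑ k ∈ range T with ¬|2 * ((k : ℕ) : ℝ) - t| ≤ 736 * r, Real.exp (-368) *
          (windWeight n k₁ k₂ k * Real.exp (1 / r * (k - t / 2))
            + windWeight n k₁ k₂ k * Real.exp (-(1 / r) * (k - t / 2))) := sum_le_sum hpt
      _ ≤ ∑ k ∈ range T, Real.exp (-368) *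
          (windWeight n k₁ k₂ k * Real.exp (1 / r * (k - t / 2))
            + windWeight n k₁ k₂ k * Real.exp (-(1 / r) * (k - t / 2))) :=
          sum_le_sum_of_subset_of_nonneg (filter_subset _ _) fun k _ _ => by
            have hw := windWeight_nonneg hn k₁ k₂ k
            positivity
      _ ≤ Real.exp (-368) * (9 * (1 / 2) ^ (k₁ + k₂) * Real.exp 364
          + 9 * (1 / 2) ^ (k₁ + k₂) * Real.exp 364) := by
          rw [← mul_sum, sum_add_distrib]
          gcongr
          · exact hmom _ T (abs_of_pos (by positivity))
          · exact hmom _ T (by rw [abs_neg]; exact abs_of_pos (by positivity))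
      _ = 18 * Real.exp (-4) * (1 / 2) ^ (k₁ + k₂) := by
          rw [show (-4 : ℝ) = -368 + 364 by norm_num, Real.exp_add]; ring
      _ ≤ _ := by gcongr
  have hpart : ∀ T : ℕ, ∑ k ∈ range T, windWeight n k₁ k₂ k ≤
      ∑ k ∈ range (t + 1) with |2 * ((k : ℕ) : ℝ) - t| ≤ 736 * r, windWeight n k₁ k₂ k
        + 1 / 2 * (1 / 2) ^ (k₁ + k₂) := by
    intro T
    rw [← sum_filter_add_sum_filter_not (range T) fun k : ℕ => |2 * ((k : ℕ) : ℝ) - t| ≤ 736 * r]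
    refine add_le_add (sum_le_sum_of_subset_of_nonneg (fun k hk => ?_) fun k _ _ =>
      windWeight_nonneg hn _ _ _) (hfar T)
    rw [mem_filter] at hk ⊢
    refine ⟨?_, hk.2⟩
    have := (abs_le.1 hk.2).2
    have : (k : ℝ) ≤ t := by nlinarith
    rw [mem_range]
    have : k ≤ t := by exact_mod_cast this
    omega
  have := le_of_tendsto' hsum.tendsto_sum_nat hpart
  linarith

set_option maxHeartbeats 1000000 in
lemma exists_return_prob_lower : ∃ c : ℝ, 0 < c ∧ ∃ Q₀ : ℝ, ∀ (n t : ℕ) (Q : ℝ),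
    (n : ℝ) = Q ^ 4 → 4 ∣ n → Q₀ ≤ Q → Q ^ 6 / 50 ≤ t → t ≤ 10 * Q ^ 6 →
      c / n ≤ (tcP n ^ t) (Sum.inl ()) (Sum.inl ()) := by
  obtain ⟨c₁, hc₁, T₁, hT₁⟩ := fairBinom_lower 736 (by norm_num)
  obtain ⟨c₂, hc₂, T₂, hT₂⟩ := fairBinom_lower 900 (by norm_num)
  refine ⟨c₁ * c₂ / 32, by positivity, max 100000 (max (T₁ : ℝ) (T₂ : ℝ)), ?_⟩
  intro n t Q hnQ h4 hQ' ht1 ht2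
  have hQ : 100000 ≤ Q := (le_max_left _ _).trans hQ'
  have hQT₁ : (T₁ : ℝ) ≤ Q := (le_max_left _ _).trans ((le_max_right _ _).trans hQ')
  have hQT₂ : (T₂ : ℝ) ≤ Q := (le_max_right _ _).trans ((le_max_right _ _).trans hQ')
  have hQ0 : 0 < Q := by linarith
  have hn0 : (0 : ℝ) < n := by rw [hnQ]; positivity
  have hn2 : 2 ≤ n := by
    have := Nat.le_of_dvd (by exact_mod_cast hn0) h4
    omega
  have hQ2 : 100000 * Q ≤ Q ^ 2 := by nlinarith
  have hQ6 : 100000 ^ 5 * Q ≤ Q ^ 6 := by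
    calc _ ≤ Q ^ 5 * Q := by gcongr
      _ = _ := by ring
  have ht736 : 736 ^ 2 ≤ t := by
    have : (736 ^ 2 : ℝ) ≤ t := by linarith
    exact_mod_cast this
  have htn : t ≤ n ^ 2 := by
    have : (t : ℝ) ≤ (n : ℝ) ^ 2 := by
      rw [hnQ]
      have : 10 * Q ^ 6 ≤ Q ^ 2 * Q ^ 6 := by gcongr; linarith
      linarith [show (Q ^ 4) ^ 2 = Q ^ 2 * Q ^ 6 by ring]
    exact_mod_cast this
  set r := Real.sqrt t with hr
  have hr4 : r ≤ 4 * Q ^ 3 := by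
    rw [hr, Real.sqrt_le_left (by positivity)]
    linarith [show (4 * Q ^ 3) ^ 2 = 16 * Q ^ 6 by ring, pow_pos hQ0 6]
  have hr8 : Q ^ 3 / 8 ≤ r := by
    apply Real.le_sqrt_of_sq_le
    linarith [show (Q ^ 3 / 8) ^ 2 = Q ^ 6 / 64 by ring, pow_pos hQ0 6]
  have hr0 : 0 < r := lt_of_lt_of_le (by positivity) hr8
  set τ : ℝ := t / (2 * n) with hτ
  have hτ1 : Q ^ 2 / 100 ≤ τ := by
    rw [hτ, hnQ, le_div_iff₀ (by positivity)]
    linarith [show Q ^ 2 / 100 * (2 * Q ^ 4) = Q ^ 6 / 50 by ring]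
  have hτ2 : τ ≤ 5 * Q ^ 2 := by
    rw [hτ, hnQ, div_le_iff₀ (by positivity)]
    linarith [show 5 * Q ^ 2 * (2 * Q ^ 4) = 10 * Q ^ 6 by ring]
  obtain ⟨z₁, z₂, hz, hdz⟩ := exists_loop_counts_near Q τ (by linarith)
  have hφ := goldenRatio_bounds
  have h12 : 12 / Q ≤ 1 := by rw [div_le_one hQ0]; linarith
  obtain ⟨hzl, hzu⟩ := abs_le.1 hz
  obtain ⟨hdl, hdu⟩ := abs_le.1 hdz
  have hz1 : (0 : ℝ) ≤ z₁ := by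
    by_contra hneg
    nlinarith
  have hz2 : (0 : ℝ) ≤ z₂ := by
    by_contra hneg
    nlinarith
  lift z₁ to ℕ using by exact_mod_cast hz1
  lift z₂ to ℕ using by exact_mod_cast hz2
  simp only [Int.cast_natCast] at *
  set m := z₁ + z₂ with hm
  have hmr : (m : ℝ) = z₁ + z₂ := by rw [hm]; push_cast; ring
  have hmlow : Q ^ 2 / 800 ≤ m := by nlinarith
  have hmup : (m : ℝ) ≤ τ := by nlinarith
  have hnm : n * m ≤ t := by
    have : (n : ℝ) * m ≤ t := by
      calc (n : ℝ) * m ≤ n * τ := by gcongr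
        _ = t / 2 := by rw [hτ]; field_simp
        _ ≤ t := by linarith [Nat.cast_nonneg (α := ℝ) t]
    exact_mod_cast this
  have hd : n * |windTime z₁ z₂ - τ| ≤ 96 * r := by
    calc n * |windTime z₁ z₂ - τ| ≤ n * (12 / Q) := by gcongr; exact hz
      _ = 12 * Q ^ 3 := by rw [hnQ]; field_simp
      _ ≤ _ := by linarith
  have hnear := windWeight_near_sum_ge hn2 h4 htn hnm ht736 hd
  have hT₁t : T₁ ≤ t := by
    have : (T₁ : ℝ) ≤ t := by linarith
    exact_mod_cast this
  have hT₂m : T₂ ≤ m := by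
    have : (T₂ : ℝ) ≤ m := by linarith
    exact_mod_cast this
  have hsm : Q / 30 ≤ Real.sqrt m := by
    apply Real.le_sqrt_of_sq_le
    linarith [show (Q / 30) ^ 2 = Q ^ 2 / 900 by ring]
  have hsm0 : 0 < Real.sqrt m := lt_of_lt_of_le (by positivity) hsm
  have hsm4 : Real.sqrt m ≤ 4 * Q := by
    rw [Real.sqrt_le_left (by positivity)]
    linarith [show (4 * Q) ^ 2 = 16 * Q ^ 2 by ring]
  have hbin := hT₂ m z₁ hT₂m (by
    rw [show 2 * (z₁ : ℝ) - m = z₁ - z₂ by rw [hmr]; ring]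
    linarith)
  have hinner : c₁ / r * (1 / 2 * (1 / 2) ^ m) ≤
      ∑ k ∈ range (t + 1), fairBinom t k * windWeight n z₁ z₂ k := by
    calc _ ≤ c₁ / r * ∑ k ∈ range (t + 1) with |2 * ((k : ℕ) : ℝ) - t| ≤ 736 * r,
          windWeight n z₁ z₂ k := by gcongr
      _ = ∑ k ∈ range (t + 1) with |2 * ((k : ℕ) : ℝ) - t| ≤ 736 * r,
          c₁ / r * windWeight n z₁ z₂ k := mul_sum _ _ _
      _ ≤ ∑ k ∈ range (t + 1) with |2 * ((k : ℕ) : ℝ) - t| ≤ 736 * r,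
          fairBinom t k * windWeight n z₁ z₂ k := by
          refine sum_le_sum fun k hk => ?_
          have := windWeight_nonneg hn2 z₁ z₂ k
          gcongr
          exact hT₁ t k hT₁t (mem_filter.1 hk).2
      _ ≤ _ := sum_le_sum_of_subset_of_nonneg (filter_subset _ _) fun k _ _ =>
          mul_nonneg (fairBinom_nonneg _ _) (windWeight_nonneg hn2 _ _ _)
  have hnn : ∀ (m : ℕ) (p : ℕ × ℕ), 0 ≤ (m.choose p.1 : ℝ) *
      ∑ k ∈ range (t + 1), fairBinom t k * windWeight n p.1 p.2 k := fun m p =>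
    mul_nonneg (Nat.cast_nonneg _) (sum_nonneg fun k _ =>
      mul_nonneg (fairBinom_nonneg _ _) (windWeight_nonneg hn2 _ _ _))
  calc c₁ * c₂ / 32 / n = c₁ / (4 * Q ^ 3) * (1 / 2) * (c₂ / (4 * Q)) := by
        rw [hnQ]; field_simp; norm_num
    _ ≤ c₁ / r * (1 / 2) * fairBinom m z₁ := by
        have : c₂ / (4 * Q) ≤ c₂ / Real.sqrt m := by gcongr
        gcongr
        exact this.trans hbin
    _ = (m.choose z₁ : ℝ) * (c₁ / r * (1 / 2 * (1 / 2) ^ m)) := by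
        rw [fairBinom, one_div_pow]; ring
    _ ≤ (m.choose z₁ : ℝ) * ∑ k ∈ range (t + 1), fairBinom t k * windWeight n z₁ z₂ k := by
        gcongr
    _ ≤ ∑ p ∈ antidiagonal m, (m.choose p.1 : ℝ) *
          ∑ k ∈ range (t + 1), fairBinom t k * windWeight n p.1 p.2 k :=
        single_le_sum (f := fun p : ℕ × ℕ => (m.choose p.1 : ℝ) *
          ∑ k ∈ range (t + 1), fairBinom t k * windWeight n p.1 p.2 k) (a := (z₁, z₂))
          (fun p _ => hnn m p) (by simp [hm])
    _ ≤ ∑ m ∈ range (t + m + 1), ∑ p ∈ antidiagonal m, (m.choose p.1 : ℝ) *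
          ∑ k ∈ range (t + 1), fairBinom t k * windWeight n p.1 p.2 k :=
        single_le_sum (f := fun m => ∑ p ∈ antidiagonal m, (m.choose p.1 : ℝ) *
          ∑ k ∈ range (t + 1), fairBinom t k * windWeight n p.1 p.2 k)
          (fun m _ => sum_nonneg fun p _ => hnn m p) (mem_range.2 (by omega))
    _ = _ := (tcP_pow_eq_sum_windGreen hn2 (by omega)).symm

/-- There are positive constants `c, C` such that for all sufficiently large
`n` divisible by `4`, the two-cycle chain with golden-ratio laziness satisfies
`c/n ≤ P^t(o,o) ≤ C/n` for every integer `t` with `n^{3/2}/50 ≤ t ≤ 10·n^{3/2}`. -/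
theorem twoCycle_return_prob_origin :
    ∃ c C : ℝ, 0 < c ∧ 0 < C ∧
      ∃ N : ℕ, ∀ n : ℕ, N ≤ n → 4 ∣ n →
        ∀ t : ℕ, (n : ℝ) ^ ((3 : ℝ) / 2) / 50 ≤ (t : ℝ) →
          (t : ℝ) ≤ 10 * (n : ℝ) ^ ((3 : ℝ) / 2) →
          c / (n : ℝ) ≤ (tcP n ^ t) (Sum.inl ()) (Sum.inl ()) ∧
          (tcP n ^ t) (Sum.inl ()) (Sum.inl ()) ≤ C / (n : ℝ) := by
  obtain ⟨c, hc, Q₀, hlow⟩ := exists_return_prob_lower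
  obtain ⟨C, hC, hup⟩ := exists_return_prob_upper
  refine ⟨c, C, hc, hC, ⌈(max 20 Q₀) ^ 4⌉₊, fun n hn h4 t ht1 ht2 => ?_⟩
  have hn0 : (0 : ℝ) ≤ n := Nat.cast_nonneg n
  set Q : ℝ := (n : ℝ) ^ (1 / 4 : ℝ) with hQdef
  have hQ0 : 0 ≤ Q := Real.rpow_nonneg hn0 _
  have hQ4 : (n : ℝ) = Q ^ 4 := by
    rw [hQdef, ← Real.rpow_mul_natCast hn0]; norm_num
  have hQ6 : (n : ℝ) ^ ((3 : ℝ) / 2) = Q ^ 6 := by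
    rw [hQdef, ← Real.rpow_mul_natCast hn0]; norm_num
  have hQ : max 20 Q₀ ≤ Q := by
    refine le_of_pow_le_pow_left₀ (n := 4) (by norm_num) hQ0 ?_
    rw [← hQ4]
    exact (Nat.le_ceil _).trans (Nat.cast_le.2 hn)
  rw [hQ6] at ht1 ht2
  exact ⟨hlow n t Q hQ4 h4 ((le_max_right _ _).trans hQ) ht1 ht2,
    hup n t Q hQ4 h4 ((le_max_left _ _).trans hQ) ht1 ht2⟩
end
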